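/- (Strong Jordan separation) Let n ≥ 2, let f : S^n → S^{n+1} be a continuous map, and let I ⊆ S^n be its set of injectivity. Assume I contains a nonempty open set U and let q ∈ U. Then: (1) f(S^n) separates S^{n+1}, i.e. S^{n+1} \ f(S^n) is nonempty and disconnected; (2) there are precisely two connected components U₁, U₂ of S^{n+1} \ f(S^n) which contain f(q) in their closure; (3) if D^{n+1} denotes the closed unit ball in ℝ^{n+1} (whose boundary is S^n) and F : D^{n+1} → S^{n+1} is any continuous map whose restriction to S^n equals f, then U₁ ⊆ F(D^{n+1}) or U₂ ⊆ F(D^{n+1}). -/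

import Mathlib

/-- `C` is a connected component of the subset `S` of a topological space. -/
def IsConnCompIn {α : Type*} [TopologicalSpace α] (S C : Set α) : Prop :=
  ∃ x ∈ S, C = connectedComponentIn S x

namespace AnalyticDegree

open MeasureTheory Set Filter Topology Metric Bornology

section Divergence

variable {E : Type*} [NormedAddCommGroup E] [InnerProductSpace ℝ E] [FiniteDimensional ℝ E]
  [MeasurableSpace E] [BorelSpace E]

/-- The directional derivative of a `C¹` function that vanishes near the boundary of a bounded open
set integrates to zero over this set. -/
theorem setIntegral_fderiv_eq_zero {Y : E → ℝ} (hY : ContDiff ℝ 1 Y) {Ω : Set E}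
    (hΩ : IsOpen Ω) (hb : IsBounded Ω) (h0 : ∀ x ∈ frontier Ω, Y =ᶠ[𝓝 x] 0) (v : E) :
    ∫ x in Ω, fderiv ℝ Y x v = 0 := by
  set X : E → ℝ := Ω.indicator Y with hX
  have h1 : ∀ x ∈ Ω, X =ᶠ[𝓝 x] Y := fun x hx => by
    filter_upwards [hΩ.mem_nhds hx] with y hy
    simp [hX, hy]
  have h2 : ∀ x ∉ Ω, X =ᶠ[𝓝 x] 0 := fun x hx => by
    by_cases hc : x ∈ closure Ω
    · have hf : x ∈ frontier Ω := by rw [hΩ.frontier_eq]; exact ⟨hc, hx⟩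
      filter_upwards [h0 x hf] with y hy
      by_cases hyΩ : y ∈ Ω
      · simp [hX, hyΩ, hy]
      · simp [hX, hyΩ]
    · filter_upwards [isClosed_closure.isOpen_compl.mem_nhds hc] with y hy
      have : y ∉ Ω := fun h => hy (subset_closure h)
      simp [hX, this]
  have hXC : ContDiff ℝ 1 X := by
    rw [contDiff_iff_contDiffAt]
    intro x
    by_cases hx : x ∈ Ω
    · exact hY.contDiffAt.congr_of_eventuallyEq (h1 x hx)
    · exact (contDiffAt_const (c := (0 : ℝ))).congr_of_eventuallyEq (h2 x hx)
  have hcs : HasCompactSupport X :=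
    HasCompactSupport.intro hb.isCompact_closure fun x hx => by
      have : x ∉ Ω := fun h => hx (subset_closure h)
      simp [hX, this]
  have hfd : ∀ x, fderiv ℝ X x v = Ω.indicator (fun x => fderiv ℝ Y x v) x := fun x => by
    by_cases hx : x ∈ Ω
    · rw [(h1 x hx).fderiv_eq]; simp [hx]
    · rw [(h2 x hx).fderiv_eq]; simp [hx]
  have hint : Integrable (fun x => fderiv ℝ X x v) := by
    apply Continuous.integrable_of_hasCompactSupport
    · exact (hXC.continuous_fderiv one_ne_zero).clm_apply continuous_const
    · exact hcs.fderiv_apply ℝ v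
  have key := integral_mul_fderiv_eq_neg_fderiv_mul_of_integrable (μ := (volume : Measure E))
    (f := fun _ => (1 : ℝ)) (g := X) (v := v) (by simp)
    (by simpa using hint) (by simpa using hXC.continuous.integrable_of_hasCompactSupport hcs)
    (fun _ _ => differentiableAt_const _) (fun x _ => hXC.differentiable one_ne_zero x)
  simp only [one_mul, fderiv_fun_const, Pi.zero_apply, zero_apply, zero_mul,
    integral_zero, neg_zero] at key
  rw [← integral_indicator hΩ.measurableSet, ← key]
  exact integral_congr_ae (Eventually.of_forall fun x => (hfd x).symm)

end Divergence

section Piola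

variable {E : Type*} [NormedAddCommGroup E] [NormedSpace ℝ E]
variable {ι : Type*} [DecidableEq ι]

theorem alternating_update_update_swap (M : E [⋀^ι]→L[ℝ] ℝ) (v : ι → E) {i j : ι} (hij : i ≠ j)
    (a b : E) : M (Function.update (Function.update v i a) j b)
      = - M (Function.update (Function.update v j a) i b) := by
  have := M.toAlternatingMap.map_swap (Function.update (Function.update v j a) i b) hij
  simp only [ContinuousAlternatingMap.coe_toAlternatingMap] at this
  rw [← this]
  congr 1
  ext k
  by_cases hk : k = j
  · subst hk; simp
  · by_cases hk' : k = i
    · subst hk'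
      simp [hij, Ne.symm hij]
    · simp [hk, hk', Equiv.swap_apply_of_ne_of_ne hk' hk]

/-- The column-wise cofactor field of a Jacobian, paired with a vector field `h`. -/
noncomputable def cofactorField (M : E [⋀^ι]→L[ℝ] ℝ) (e : ι → E) (F h : E → E) (j : ι) (x : E) : ℝ :=
  M (Function.update (fun i => fderiv ℝ F x (e i)) j (h x))

variable [Fintype ι]

theorem contDiff_cofactorField (M : E [⋀^ι]→L[ℝ] ℝ) (e : ι → E) {F h : E → E}
    (hF : ContDiff ℝ 2 F) (hh : ContDiff ℝ 1 h) (j : ι) :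
    ContDiff ℝ 1 (cofactorField M e F h j) := by
  unfold cofactorField
  refine M.toContinuousMultilinearMap.contDiff.comp (contDiff_pi.2 fun i => ?_)
  by_cases hi : i = j
  · subst hi; simpa using hh
  · simp only [Function.update_of_ne hi]
    exact (hF.fderiv_right (m := 1) (by norm_num)).clm_apply contDiff_const

/-- **Piola's identity**: the divergence of the cofactor field only involves the derivative
of `h`. -/
theorem sum_fderiv_cofactorField (M : E [⋀^ι]→L[ℝ] ℝ) (e : ι → E) {F h : E → E}
    (hF : ContDiff ℝ 2 F) (hh : ContDiff ℝ 1 h) (x : E) :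
    ∑ j, fderiv ℝ (cofactorField M e F h j) x (e j)
      = ∑ j, M (Function.update (fun i => fderiv ℝ F x (e i)) j (fderiv ℝ h x (e j))) := by
  set v : ι → E := fun i => fderiv ℝ F x (e i) with hv
  have hF' : ContDiff ℝ 1 (fderiv ℝ F) := hF.fderiv_right (by norm_num)
  have hder : ∀ i, HasFDerivAt (fun y => fderiv ℝ F y (e i))
      ((fderiv ℝ (fderiv ℝ F) x).flip (e i)) x := fun i => by
    have := (hF'.differentiable one_ne_zero x).hasFDerivAt.clm_apply
      (hasFDerivAt_const (e i) x)
    simpa using this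
  have hd : ∀ j, fderiv ℝ (cofactorField M e F h j) x (e j)
      = ∑ i, if i = j then M (Function.update v j (fderiv ℝ h x (e j)))
        else M (Function.update (Function.update v j (h x)) i
          (fderiv ℝ (fderiv ℝ F) x (e j) (e i))) := fun j => by
    have h1 : ∀ i, HasFDerivAt
        (fun y => Function.update (fun i => fderiv ℝ F y (e i)) j (h y) i)
        (if i = j then fderiv ℝ h x else (fderiv ℝ (fderiv ℝ F) x).flip (e i)) x := fun i => by
      by_cases hi : i = j
      · subst hi; simpa using (hh.differentiable one_ne_zero x).hasFDerivAt
      · simpa [hi] using hder i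
    have h2 := HasFDerivAt.multilinear_comp M.toContinuousMultilinearMap h1
    have h3 : fderiv ℝ (cofactorField M e F h j) x = _ := h2.fderiv
    rw [h3]
    simp only [sum_apply, ContinuousLinearMap.comp_apply]
    refine Finset.sum_congr rfl fun i _ => ?_
    by_cases hi : i = j
    · subst hi
      simp [ContinuousMultilinearMap.toContinuousLinearMap, hv]
    · simp [ContinuousMultilinearMap.toContinuousLinearMap, hi, hv]
  simp_rw [hd]
  set a : ι → ι → ℝ := fun j i => if i = j then 0 else
    M (Function.update (Function.update v j (h x)) i (fderiv ℝ (fderiv ℝ F) x (e j) (e i))) with ha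
  have hsplit : ∀ j, (∑ i, if i = j then M (Function.update v j (fderiv ℝ h x (e j)))
        else M (Function.update (Function.update v j (h x)) i
          (fderiv ℝ (fderiv ℝ F) x (e j) (e i))))
      = M (Function.update v j (fderiv ℝ h x (e j))) + ∑ i, a j i := fun j => by
    have : ∀ i, (if i = j then M (Function.update v j (fderiv ℝ h x (e j)))
        else M (Function.update (Function.update v j (h x)) i
          (fderiv ℝ (fderiv ℝ F) x (e j) (e i))))
        = (if i = j then M (Function.update v j (fderiv ℝ h x (e j))) else 0) + a j i := fun i => by
      by_cases hi : i = j <;> simp [ha, hi]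
    simp_rw [this, Finset.sum_add_distrib]
    simp
  simp_rw [hsplit, Finset.sum_add_distrib]
  have hsym : ∀ i j, a i j = - a j i := fun i j => by
    by_cases hij : i = j
    · simp [ha, hij]
    · have hs : fderiv ℝ (fderiv ℝ F) x (e i) (e j) = fderiv ℝ (fderiv ℝ F) x (e j) (e i) :=
        (hF.contDiffAt.isSymmSndFDerivAt (by simp)) _ _
      simp only [ha, hij, Ne.symm hij, if_false, hs]
      exact alternating_update_update_swap M v hij _ _
  have hz : ∑ j, ∑ i, a j i = 0 := by
    have h1 : ∑ j, ∑ i, a j i = - ∑ j, ∑ i, a j i := by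
      conv_lhs => rw [Finset.sum_comm]
      rw [← Finset.sum_neg_distrib]
      refine Finset.sum_congr rfl fun j _ => ?_
      rw [← Finset.sum_neg_distrib]
      exact Finset.sum_congr rfl fun i _ => hsym i j
    linarith
  rw [hz, add_zero]

end Piola

section HomotopyFormula

variable {E : Type*} [NormedAddCommGroup E] [InnerProductSpace ℝ E] [FiniteDimensional ℝ E]

section DetForm

variable (E) in
/-- The determinant in the standard orthonormal basis, as a continuous alternating map. -/
noncomputable def detForm : E [⋀^Fin (Module.finrank ℝ E)]→L[ℝ] ℝ :=
  { (stdOrthonormalBasis ℝ E).toBasis.det with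
    cont := by
      change Continuous fun v : Fin (Module.finrank ℝ E) → E =>
        (stdOrthonormalBasis ℝ E).toBasis.det v
      simp only [Module.Basis.det_apply]
      refine Continuous.matrix_det ?_
      refine continuous_matrix fun i j => ?_
      simp only [Module.Basis.toMatrix_apply]
      exact (LinearMap.continuous_of_finiteDimensional
        ((stdOrthonormalBasis ℝ E).toBasis.coord i)).comp (continuous_apply j) }

theorem detForm_apply (v : Fin (Module.finrank ℝ E) → E) :
    detForm E v = (stdOrthonormalBasis ℝ E).toBasis.det v := rfl

theorem detForm_map (A : E →L[ℝ] E) :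
    detForm E (fun i => A (stdOrthonormalBasis ℝ E i)) = A.det := by
  have := (stdOrthonormalBasis ℝ E).toBasis.det_comp (A : E →ₗ[ℝ] E)
    (stdOrthonormalBasis ℝ E).toBasis
  rw [Module.Basis.det_self, mul_one] at this
  rw [detForm_apply, ContinuousLinearMap.det, ← this]
  congr 1

/-- **Cramer's rule** for `detForm`. -/
theorem sum_detForm_update_smul (v : Fin (Module.finrank ℝ E) → E) (u : E) :
    ∑ j, detForm E (Function.update v j u) • v j = detForm E v • u := by
  set b := (stdOrthonormalBasis ℝ E).toBasis with hb
  apply b.repr.injective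
  ext k
  have := congrFun (Matrix.mulVec_cramer (b.toMatrix v) (b.repr u)) k
  simp only [Matrix.mulVec, dotProduct, Matrix.cramer_apply, Pi.smul_apply, smul_eq_mul,
    Module.Basis.toMatrix_apply] at this
  simp only [map_sum, map_smul, Finsupp.coe_finsetSum, Finset.sum_apply, Finsupp.smul_apply,
    smul_eq_mul, detForm_apply, ← hb, Module.Basis.det_apply, Module.Basis.toMatrix_update]
  rw [← this]
  exact Finset.sum_congr rfl fun j _ => mul_comm _ _

end DetForm

section Homotopy

/-- Weighted Jacobian along the straight-line homotopy from `f` in direction `h`. -/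
noncomputable def homotopyIntegrand (w : E → ℝ) (f h : E → E) (t : ℝ) (x : E) : ℝ :=
  w (f x + t • h x) * (fderiv ℝ f x + t • fderiv ℝ h x).det

/-- The time derivative of `homotopyIntegrand`. -/
noncomputable def homotopyDeriv (w : E → ℝ) (f h : E → E) (t : ℝ) (x : E) : ℝ :=
  fderiv ℝ w (f x + t • h x) (h x) * (fderiv ℝ f x + t • fderiv ℝ h x).det
    + w (f x + t • h x) * ∑ j, detForm E (Function.update
        (fun i => (fderiv ℝ f x + t • fderiv ℝ h x) (stdOrthonormalBasis ℝ E i)) j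
        (fderiv ℝ h x (stdOrthonormalBasis ℝ E j)))

theorem hasDerivAt_homotopyIntegrand {w : E → ℝ} (hw : ContDiff ℝ 1 w) (f h : E → E) (x : E)
    (t : ℝ) :
    HasDerivAt (fun t => homotopyIntegrand w f h t x) (homotopyDeriv w f h t x) t := by
  have h1 : HasDerivAt (fun t : ℝ => f x + t • h x) (h x) t := by
    simpa using ((hasDerivAt_id t).smul_const (h x)).const_add (f x)
  have h2 : HasDerivAt (fun t : ℝ => w (f x + t • h x)) (fderiv ℝ w (f x + t • h x) (h x)) t :=
    (hw.differentiable one_ne_zero _).hasFDerivAt.comp_hasDerivAt t h1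
  have h3 : HasDerivAt (fun t : ℝ => (fderiv ℝ f x + t • fderiv ℝ h x).det)
      (∑ j, detForm E (Function.update
        (fun i => (fderiv ℝ f x + t • fderiv ℝ h x) (stdOrthonormalBasis ℝ E i)) j
        (fderiv ℝ h x (stdOrthonormalBasis ℝ E j)))) t := by
    have h4 : ∀ i, HasFDerivAt (fun t : ℝ => (fderiv ℝ f x + t • fderiv ℝ h x)
        (stdOrthonormalBasis ℝ E i)) (ContinuousLinearMap.toSpanSingleton ℝ
        (fderiv ℝ h x (stdOrthonormalBasis ℝ E i))) t := fun i => by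
      have := ((hasDerivAt_id t).smul_const (fderiv ℝ h x (stdOrthonormalBasis ℝ E i))).const_add
        (fderiv ℝ f x (stdOrthonormalBasis ℝ E i))
      simpa [hasDerivAt_iff_hasFDerivAt] using this
    have h5 := (HasFDerivAt.multilinear_comp (detForm E).toContinuousMultilinearMap h4).hasDerivAt
    simp only [← detForm_map]
    convert! h5 using 1
    simp [ContinuousMultilinearMap.toContinuousLinearMap]
  exact h2.mul h3

theorem homotopyDeriv_eq_sum_fderiv {w : E → ℝ} (hw : ContDiff ℝ 1 w) {f h : E → E}
    (hf : ContDiff ℝ 2 f) (hh : ContDiff ℝ 2 h) (t : ℝ) (x : E) :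
    homotopyDeriv w f h t x = ∑ j, fderiv ℝ (fun y => w (f y + t • h y) *
      cofactorField (detForm E) (stdOrthonormalBasis ℝ E) (fun y => f y + t • h y) h j y) x
        (stdOrthonormalBasis ℝ E j) := by
  set F : E → E := fun y => f y + t • h y with hFdef
  have hF : ContDiff ℝ 2 F := hf.add (contDiff_const.smul hh)
  have hF' : fderiv ℝ F x = fderiv ℝ f x + t • fderiv ℝ h x := by
    have := ((hf.differentiable two_ne_zero x).hasFDerivAt.add
      ((hh.differentiable two_ne_zero x).hasFDerivAt.const_smul t))
    exact this.fderiv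
  have hh1 : ContDiff ℝ 1 h := hh.of_le (by norm_num)
  have hwF : HasFDerivAt (fun y => w (F y)) ((fderiv ℝ w (F x)).comp (fderiv ℝ F x)) x :=
    (hw.differentiable one_ne_zero _).hasFDerivAt.comp x
      (hF.differentiable two_ne_zero x).hasFDerivAt
  have hd : ∀ j, fderiv ℝ (fun y => w (F y) *
      cofactorField (detForm E) (stdOrthonormalBasis ℝ E) F h j y) x (stdOrthonormalBasis ℝ E j)
      = w (F x) * fderiv ℝ (cofactorField (detForm E) (stdOrthonormalBasis ℝ E) F h j) x
          (stdOrthonormalBasis ℝ E j)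
        + fderiv ℝ w (F x) (detForm E (Function.update
          (fun i => fderiv ℝ F x (stdOrthonormalBasis ℝ E i)) j (h x))
          • fderiv ℝ F x (stdOrthonormalBasis ℝ E j)) := fun j => by
    have := hwF.mul ((contDiff_cofactorField (detForm E) (stdOrthonormalBasis ℝ E) hF hh1
      j).differentiable one_ne_zero x).hasFDerivAt
    rw [HasFDerivAt.fderiv (f := fun y => w (F y) *
      cofactorField (detForm E) (stdOrthonormalBasis ℝ E) F h j y) this]
    simp [cofactorField]
  change _ = ∑ j, fderiv ℝ (fun y => w (F y) *
    cofactorField (detForm E) (stdOrthonormalBasis ℝ E) F h j y) x (stdOrthonormalBasis ℝ E j)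
  simp_rw [hd, Finset.sum_add_distrib, ← Finset.mul_sum, ← map_sum]
  rw [sum_fderiv_cofactorField _ _ hF hh1, sum_detForm_update_smul, detForm_map, homotopyDeriv,
    hF', map_smul, smul_eq_mul]
  ring

end Homotopy

end HomotopyFormula

section JacobianIntegral

variable {E : Type*} [NormedAddCommGroup E] [InnerProductSpace ℝ E] [FiniteDimensional ℝ E]

theorem continuous_homotopyDeriv {w : E → ℝ} (hw : ContDiff ℝ 1 w) {f h : E → E}
    (hf : ContDiff ℝ 2 f) (hh : ContDiff ℝ 2 h) :
    Continuous (Function.uncurry (homotopyDeriv w f h)) := by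
  have hf0 := hf.continuous
  have hh0 := hh.continuous
  have hw0 := hw.continuous
  have hf1 : Continuous (fderiv ℝ f) := hf.continuous_fderiv two_ne_zero
  have hh1 : Continuous (fderiv ℝ h) := hh.continuous_fderiv two_ne_zero
  have hw1 : Continuous (fderiv ℝ w) := hw.continuous_fderiv one_ne_zero
  have hD : Continuous fun p : ℝ × E => fderiv ℝ f p.2 + p.1 • fderiv ℝ h p.2 := by fun_prop
  have hdet : Continuous fun p : ℝ × E => (fderiv ℝ f p.2 + p.1 • fderiv ℝ h p.2).det :=
    ContinuousLinearMap.continuous_det.comp hD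
  unfold homotopyDeriv Function.uncurry
  refine Continuous.add (Continuous.mul ?_ hdet) (Continuous.mul (by fun_prop) ?_)
  · exact (hw1.comp (by fun_prop : Continuous fun p : ℝ × E => f p.2 + p.1 • h p.2)).clm_apply
      (by fun_prop)
  · refine continuous_finsetSum _ fun j _ => (detForm E).cont.comp (continuous_pi fun i => ?_)
    by_cases hij : i = j
    · subst hij
      simp only [Function.update_self]
      exact (hh1.comp continuous_snd).clm_apply continuous_const
    · simp only [Function.update_of_ne hij]
      exact hD.clm_apply continuous_const

variable [MeasurableSpace E] [BorelSpace E]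

theorem setIntegral_homotopyDeriv_eq_zero {w : E → ℝ} (hw : ContDiff ℝ 1 w)
    (hw1 : ∀ y, 1 ≤ ‖y‖ → w y = 0) {f h : E → E}
    (hf : ContDiff ℝ 2 f) (hh : ContDiff ℝ 2 h) {Ω : Set E} (hΩ : IsOpen Ω) (hb : IsBounded Ω)
    {t : ℝ} (ht : ∀ x ∈ frontier Ω, 1 < ‖f x + t • h x‖) :
    ∫ x in Ω, homotopyDeriv w f h t x = 0 := by
  have hF : ContDiff ℝ 2 fun y => f y + t • h y := hf.add (contDiff_const.smul hh)
  have hF1 : ContDiff ℝ 1 fun y => f y + t • h y := hF.of_le (by norm_num)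
  have hh1 : ContDiff ℝ 1 h := hh.of_le (by norm_num)
  have hY : ∀ j, ContDiff ℝ 1 (fun y => w (f y + t • h y) *
      cofactorField (detForm E) (stdOrthonormalBasis ℝ E) (fun y => f y + t • h y) h j y) :=
    fun j => (hw.comp hF1).mul (contDiff_cofactorField _ _ hF hh1 j)
  simp_rw [homotopyDeriv_eq_sum_fderiv hw hf hh]
  rw [integral_finsetSum]
  · refine Finset.sum_eq_zero fun j _ => setIntegral_fderiv_eq_zero (hY j) hΩ hb
      (fun x hx => ?_) _
    have : ∀ᶠ y in 𝓝 x, 1 < ‖f y + t • h y‖ :=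
      (hF.continuous.norm.continuousAt).eventually_const_lt (ht x hx)
    filter_upwards [this] with y hy
    simp [hw1 _ hy.le]
  · intro j _
    have hc : Continuous fun x => fderiv ℝ (fun y => w (f y + t • h y) *
      cofactorField (detForm E) (stdOrthonormalBasis ℝ E) (fun y => f y + t • h y) h j y) x
        (stdOrthonormalBasis ℝ E j) :=
      ((hY j).continuous_fderiv one_ne_zero).clm_apply continuous_const
    exact (hc.continuousOn.integrableOn_compact hb.isCompact_closure).mono_set subset_closure

/-- Homotopy invariance of the weighted Jacobian integral. -/
theorem setIntegral_jacobian_eq {w : E → ℝ} (hw : ContDiff ℝ 1 w)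
    (hw1 : ∀ y, 1 ≤ ‖y‖ → w y = 0) {f g : E → E}
    (hf : ContDiff ℝ 2 f) (hg : ContDiff ℝ 2 g) {Ω : Set E} (hΩ : IsOpen Ω) (hb : IsBounded Ω)
    (hfg : ∀ x ∈ frontier Ω, ∀ t ∈ Icc (0 : ℝ) 1, 1 < ‖f x + t • (g x - f x)‖) :
    ∫ x in Ω, w (f x) * (fderiv ℝ f x).det = ∫ x in Ω, w (g x) * (fderiv ℝ g x).det := by
  set h : E → E := fun x => g x - f x with hh'
  have hh : ContDiff ℝ 2 h := hg.sub hf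
  have hcont := continuous_homotopyDeriv hw hf hh
  have hfd : ∀ x, fderiv ℝ h x = fderiv ℝ g x - fderiv ℝ f x := fun x =>
    ((hg.differentiable two_ne_zero x).hasFDerivAt.sub
      (hf.differentiable two_ne_zero x).hasFDerivAt).fderiv
  have hftc : ∀ x, ∫ t in (0 : ℝ)..1, homotopyDeriv w f h t x
      = w (g x) * (fderiv ℝ g x).det - w (f x) * (fderiv ℝ f x).det := fun x => by
    rw [intervalIntegral.integral_eq_sub_of_hasDerivAt
      (f := fun t => homotopyIntegrand w f h t x)
      (fun t _ => hasDerivAt_homotopyIntegrand hw f h x t)]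
    · simp only [homotopyIntegrand, hfd]
      simp [hh']
    · exact Continuous.intervalIntegrable
        (hcont.comp (by fun_prop : Continuous fun t : ℝ => (t, x))) _ _
  have hint : Integrable (Function.uncurry (homotopyDeriv w f h))
      ((volume.restrict (Set.uIoc (0 : ℝ) 1)).prod (volume.restrict Ω)) := by
    rw [Measure.prod_restrict]
    have hK : IsCompact (Icc (0 : ℝ) 1 ×ˢ closure Ω) := isCompact_Icc.prod hb.isCompact_closure
    refine (hcont.continuousOn.integrableOn_compact hK).mono_set (Set.prod_mono ?_ subset_closure)
    rw [uIoc_of_le zero_le_one]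
    exact Ioc_subset_Icc_self
  have hswap := intervalIntegral_integral_swap hint
  simp_rw [hftc] at hswap
  have hI : ∀ {F : E → E}, ContDiff ℝ 2 F →
      IntegrableOn (fun x => w (F x) * (fderiv ℝ F x).det) Ω := fun {F} hF => by
    have : Continuous fun x => w (F x) * (fderiv ℝ F x).det :=
      (hw.continuous.comp hF.continuous).mul
        (ContinuousLinearMap.continuous_det.comp (hF.continuous_fderiv two_ne_zero))
    exact (this.continuousOn.integrableOn_compact hb.isCompact_closure).mono_set subset_closure
  rw [integral_sub (hI hg) (hI hf)] at hswap
  have hz : ∫ t in (0 : ℝ)..1, ∫ x in Ω, homotopyDeriv w f h t x = 0 := by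
    rw [intervalIntegral.integral_congr (g := fun _ => (0 : ℝ))]
    · simp
    · intro t ht
      rw [uIcc_of_le zero_le_one] at ht
      exact setIntegral_homotopyDeriv_eq_zero hw hw1 hf hh hΩ hb fun x hx => hfg x hx t ht
  rw [hz] at hswap
  linarith

end JacobianIntegral

section Degree

theorem _root_.IsCompact.exists_pos_forall_le {X : Type*} [TopologicalSpace X] {K : Set X}
    (hK : IsCompact K) {φ : X → ℝ} (hφ : ContinuousOn φ K) (hpos : ∀ x ∈ K, 0 < φ x) :
    ∃ δ > 0, ∀ x ∈ K, δ ≤ φ x := by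
  rcases K.eq_empty_or_nonempty with rfl | hne
  · exact ⟨1, one_pos, by simp⟩
  · obtain ⟨x, hx, hmin⟩ := hK.exists_isMinOn hne hφ
    exact ⟨φ x, hpos x hx, fun y hy => hmin hy⟩

variable {E : Type*} [NormedAddCommGroup E] [InnerProductSpace ℝ E] [FiniteDimensional ℝ E]

theorem isCompact_frontier_of_isBounded {Ω : Set E} (hb : IsBounded Ω) :
    IsCompact (frontier Ω) :=
  hb.isCompact_closure.of_isClosed_subset isClosed_frontier frontier_subset_closure

theorem exists_contDiff_near {f : E → E} (hf : Continuous f) {ε : ℝ} (hε : 0 < ε) :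
    ∃ g : E → E, ContDiff ℝ 2 g ∧ ∀ x, ‖g x - f x‖ ≤ ε := by
  obtain ⟨g, hg, hd, -⟩ := hf.exists_contDiff_approx 2 (continuous_const (y := ε)) fun _ => hε
  exact ⟨g, hg, fun x => by simpa [dist_eq_norm] using (hd x).le⟩

theorem exists_contDiff_near_smul {f : E → E} (hf : Continuous f) (l : ℝ) {ε : ℝ} (hε : 0 < ε) :
    ∃ g : E → E, ContDiff ℝ 2 g ∧ ∀ x, ‖g x - l • f x‖ ≤ ε :=
  exists_contDiff_near (hf.const_smul l) hε

/-- Smooth inner approximation of a composition on a compact set. -/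
theorem exists_contDiff_comp_near {h : E → E} (hh : Continuous h) {k : E → E} (hk : Continuous k)
    {K : Set E} (hK : IsCompact K) {ε : ℝ} (hε : 0 < ε) :
    ∃ g : E → E, ContDiff ℝ 2 g ∧ (∀ x, ‖g x - h x‖ ≤ ε) ∧ ∀ x ∈ K, ‖k (g x) - k (h x)‖ ≤ ε := by
  have hu := (hK.image hh).uniformContinuousAt_of_continuousAt k
    (fun a _ => hk.continuousAt) (Metric.dist_mem_uniformity hε)
  obtain ⟨δ, hδ, hδ'⟩ := Metric.mem_uniformity_dist.1 hu
  obtain ⟨g, hg, hgh⟩ := exists_contDiff_near hh (ε := min ε (δ / 2)) (by positivity)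
  refine ⟨g, hg, fun x => (hgh x).trans (min_le_left _ _), fun x hx => ?_⟩
  have h1 : dist (h x) (g x) < δ := by
    rw [dist_comm, dist_eq_norm]
    have := (hgh x).trans (min_le_right _ _)
    linarith
  have h2 := hδ' h1 (mem_image_of_mem h hx)
  rw [← dist_eq_norm, dist_comm]
  exact le_of_lt h2

variable [MeasurableSpace E] [BorelSpace E]

variable (E) in
/-- A smooth bump function of total mass one, positive exactly on the open unit ball. -/
noncomputable def bump : E → ℝ :=
  (⟨1 / 2, 1, by norm_num, by norm_num⟩ : ContDiffBump (0 : E)).normed volume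

theorem contDiff_bump (n : ℕ∞) : ContDiff ℝ n (bump E) := ContDiffBump.contDiff_normed _

theorem continuous_bump : Continuous (bump E) := (contDiff_bump 0).continuous

theorem bump_eq_zero {y : E} (hy : 1 ≤ ‖y‖) : bump E y = 0 := by
  have h := ContDiffBump.support_normed_eq
    (⟨1 / 2, 1, by norm_num, by norm_num⟩ : ContDiffBump (0 : E)) (μ := volume)
  by_contra hne
  have : y ∈ Function.support (bump E) := hne
  rw [bump, h] at this
  simp at this
  linarith

theorem bump_nonneg (y : E) : 0 ≤ bump E y := ContDiffBump.nonneg_normed _ _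

theorem integral_bump : ∫ y, bump E y = 1 := ContDiffBump.integral_normed _

/-- The integral of the pullback of the bump form. -/
noncomputable def smoothDegree (g : E → E) (Ω : Set E) : ℝ :=
  ∫ x in Ω, bump E (g x) * (fderiv ℝ g x).det

omit [FiniteDimensional ℝ E] [MeasurableSpace E] [BorelSpace E] in
theorem continuous_det_fderiv {g : E → E} (hg : ContDiff ℝ 2 g) :
    Continuous fun x => (fderiv ℝ g x).det :=
  ContinuousLinearMap.continuous_det.comp (hg.continuous_fderiv two_ne_zero)

theorem smoothDegree_eq_zero {g : E → E} {Ω : Set E}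
    (h : ∀ x ∈ Ω, 1 ≤ ‖g x‖ ∨ (fderiv ℝ g x).det = 0) : smoothDegree g Ω = 0 := by
  refine setIntegral_eq_zero_of_forall_eq_zero fun x hx => ?_
  rcases h x hx with h | h
  · simp [bump_eq_zero h]
  · simp [h]

/-- `g` is a smooth approximation of the multiple `l • f`, good enough on the boundary of `Ω` to
compute the degree of `f` on `Ω`. -/
def IsScaledApprox (f : E → E) (Ω : Set E) (l : ℝ) (g : E → E) : Prop :=
  0 < l ∧ ContDiff ℝ 2 g ∧ ∀ x ∈ frontier Ω, 2 < l * ‖f x‖ ∧ ‖g x - l • f x‖ ≤ 1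

open Classical in
/-- The (real valued) Brouwer degree at `0` of `f` on the bounded open set `Ω`. -/
noncomputable def degree (f : E → E) (Ω : Set E) : ℝ :=
  if h : ∃ d, ∀ l g, IsScaledApprox f Ω l g → smoothDegree g Ω = d then h.choose else 0

omit [FiniteDimensional ℝ E] [MeasurableSpace E] [BorelSpace E] in
theorem one_lt_norm_of_near_segment {a b u v : E} {t : ℝ} (ht : t ∈ Icc (0 : ℝ) 1)
    (ha : ‖u - a‖ ≤ 1) (hb : ‖v - b‖ ≤ 1) (h : 2 < ‖a + t • (b - a)‖) :
    1 < ‖u + t • (v - u)‖ := by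
  have h1 : a + t • (b - a) = (u + t • (v - u)) - ((1 - t) • (u - a) + t • (v - b)) := by module
  have h2 : ‖(1 - t) • (u - a) + t • (v - b)‖ ≤ 1 := by
    refine (norm_add_le _ _).trans ?_
    rw [norm_smul, norm_smul, Real.norm_of_nonneg ht.1, Real.norm_of_nonneg (sub_nonneg.2 ht.2)]
    nlinarith [ht.1, ht.2]
  have h3 := norm_sub_le (u + t • (v - u)) ((1 - t) • (u - a) + t • (v - b))
  rw [← h1] at h3
  linarith

theorem degree_eq {f g : E → E} {Ω : Set E} (hΩ : IsOpen Ω) (hb : IsBounded Ω) {l : ℝ}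
    (h : IsScaledApprox f Ω l g) : degree f Ω = smoothDegree g Ω := by
  have hex : ∃ d, ∀ l g, IsScaledApprox f Ω l g → smoothDegree g Ω = d := by
    refine ⟨smoothDegree g Ω, fun l' g' h' => ?_⟩
    refine setIntegral_jacobian_eq (contDiff_bump 1) (fun y hy => bump_eq_zero hy) h'.2.1 h.2.1 hΩ
      hb fun x hx t ht => ?_
    refine one_lt_norm_of_near_segment ht (h'.2.2 x hx).2 (h.2.2 x hx).2 ?_
    have h1 : l' • f x + t • (l • f x - l' • f x) = ((1 - t) * l' + t * l) • f x := by module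
    have hl := h.1
    have hl' := h'.1
    have h2 := (h.2.2 x hx).1
    have h3 := (h'.2.2 x hx).1
    have h4 : 0 ≤ (1 - t) * l' + t * l :=
      add_nonneg (mul_nonneg (sub_nonneg.2 ht.2) hl'.le) (mul_nonneg ht.1 hl.le)
    rw [h1, norm_smul, Real.norm_of_nonneg h4]
    rcases eq_or_lt_of_le ht.1 with h0 | h0
    · subst h0; linarith
    · nlinarith [mul_lt_mul_of_pos_left h2 h0, mul_le_mul_of_nonneg_left h3.le (sub_nonneg.2 ht.2)]
  rw [degree, dif_pos hex]
  exact (hex.choose_spec l g h).symm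

/-- The degree is invariant under straight-line homotopies that avoid `0` on the boundary. -/
theorem degree_congr {f g : E → E} (hf : Continuous f) (hg : Continuous g) {Ω : Set E}
    (hΩ : IsOpen Ω) (hb : IsBounded Ω)
    (h : ∀ x ∈ frontier Ω, ∀ t ∈ Icc (0 : ℝ) 1, f x + t • (g x - f x) ≠ 0) :
    degree f Ω = degree g Ω := by
  have hK : IsCompact (frontier Ω ×ˢ Icc (0 : ℝ) 1) :=
    (isCompact_frontier_of_isBounded hb).prod isCompact_Icc
  obtain ⟨δ, hδ, hδ'⟩ := hK.exists_pos_forall_le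
    (φ := fun p => ‖f p.1 + p.2 • (g p.1 - f p.1)‖) (by fun_prop)
    (fun p hp => norm_pos_iff.2 (h p.1 hp.1 p.2 hp.2))
  have hl : 0 < 3 / δ := by positivity
  have hbd : ∀ x ∈ frontier Ω, ∀ t ∈ Icc (0 : ℝ) 1,
      2 < 3 / δ * ‖f x + t • (g x - f x)‖ := fun x hx t ht => by
    have := mul_le_mul_of_nonneg_left (hδ' (x, t) ⟨hx, ht⟩) hl.le
    rw [div_mul_cancel₀ _ hδ.ne'] at this
    simp only at this
    linarith
  obtain ⟨F, hF, hFf⟩ := exists_contDiff_near_smul hf (3 / δ) one_pos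
  obtain ⟨G, hG, hGg⟩ := exists_contDiff_near_smul hg (3 / δ) one_pos
  rw [degree_eq hΩ hb (l := 3 / δ) (g := F) ⟨hl, hF, fun x hx =>
      ⟨by simpa using hbd x hx 0 (by simp), hFf x⟩⟩,
    degree_eq hΩ hb (l := 3 / δ) (g := G) ⟨hl, hG, fun x hx =>
      ⟨by simpa using hbd x hx 1 (by simp), hGg x⟩⟩]
  refine setIntegral_jacobian_eq (contDiff_bump 1) (fun y hy => bump_eq_zero hy) hF hG hΩ
      hb fun x hx t ht => ?_
  refine one_lt_norm_of_near_segment ht (hFf x) (hGg x) ?_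
  have h1 : (3 / δ) • f x + t • ((3 / δ) • g x - (3 / δ) • f x)
    = (3 / δ) • (f x + t • (g x - f x)) := by module
  rw [h1, norm_smul, Real.norm_of_nonneg hl.le]
  exact hbd x hx t ht

/-- The degree only depends on the values on the boundary. -/
theorem degree_congr_of_eqOn {f g : E → E} (hf : Continuous f) (hg : Continuous g) {Ω : Set E}
    (hΩ : IsOpen Ω) (hb : IsBounded Ω) (h0 : ∀ x ∈ frontier Ω, f x ≠ 0)
    (h : EqOn f g (frontier Ω)) : degree f Ω = degree g Ω :=
  degree_congr hf hg hΩ hb fun x hx t _ => by simpa [← h hx] using h0 x hx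

omit [InnerProductSpace ℝ E] [FiniteDimensional ℝ E] [MeasurableSpace E] [BorelSpace E] in
/-- A scale that makes `f` large on a compact set on which it does not vanish. -/
theorem exists_scale {f : E → E} (hf : Continuous f) {K : Set E} (hK : IsCompact K)
    (h0 : ∀ x ∈ K, f x ≠ 0) : ∃ L > 0, ∀ l ≥ L, ∀ x ∈ K, 2 < l * ‖f x‖ := by
  obtain ⟨δ, hδ, hδ'⟩ := hK.exists_pos_forall_le (φ := fun x => ‖f x‖) (by fun_prop)
    (fun p hp => norm_pos_iff.2 (h0 p hp))
  refine ⟨3 / δ, by positivity, fun l hl x hx => ?_⟩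
  have h1 : 3 / δ * δ ≤ l * ‖f x‖ := mul_le_mul hl (hδ' x hx) hδ.le (le_trans (by positivity) hl)
  rw [div_mul_cancel₀ _ hδ.ne'] at h1
  linarith

theorem degree_eq_zero {f : E → E} (hf : Continuous f) {Ω : Set E}
    (hΩ : IsOpen Ω) (hb : IsBounded Ω) (h : ∀ x ∈ closure Ω, f x ≠ 0) : degree f Ω = 0 := by
  obtain ⟨l, hl, hl'⟩ := exists_scale hf hb.isCompact_closure h
  obtain ⟨F, hF, hFf⟩ := exists_contDiff_near_smul hf l one_pos
  rw [degree_eq hΩ hb ⟨hl, hF, fun x hx => ⟨hl' l le_rfl x (frontier_subset_closure hx), hFf x⟩⟩]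
  refine smoothDegree_eq_zero fun x hx => Or.inl ?_
  have h1 := hl' l le_rfl x (subset_closure hx)
  have h2 := norm_sub_norm_le (l • f x) (F x)
  rw [norm_sub_rev, norm_smul, Real.norm_of_nonneg hl.le] at h2
  have := hFf x
  linarith

/-- Excision. -/
theorem degree_excision {f : E → E} (hf : Continuous f) {Ω Ω' : Set E}
    (hΩ : IsOpen Ω) (hb : IsBounded Ω) (hΩ' : IsOpen Ω') (hsub : Ω' ⊆ Ω)
    (h : ∀ x ∈ closure Ω \ Ω', f x ≠ 0) : degree f Ω = degree f Ω' := by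
  have hK : IsCompact (closure Ω \ Ω') := hb.isCompact_closure.diff hΩ'
  obtain ⟨l, hl, hl'⟩ := exists_scale hf hK h
  have h1 : frontier Ω ⊆ closure Ω \ Ω' := by
    rw [hΩ.frontier_eq]; exact sdiff_subset_sdiff_right hsub
  have h2 : frontier Ω' ⊆ closure Ω \ Ω' := by
    rw [hΩ'.frontier_eq]; exact sdiff_subset_sdiff_left (closure_mono hsub)
  obtain ⟨F, hF, hFf⟩ := exists_contDiff_near_smul hf l one_pos
  rw [degree_eq hΩ hb ⟨hl, hF, fun x hx => ⟨hl' l le_rfl x (h1 hx), hFf x⟩⟩,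
    degree_eq hΩ' (hb.subset hsub) ⟨hl, hF, fun x hx => ⟨hl' l le_rfl x (h2 hx), hFf x⟩⟩]
  refine setIntegral_eq_of_subset_of_forall_sdiff_eq_zero hΩ.measurableSet hsub fun x hx => ?_
  have h1 := hl' l le_rfl x ⟨subset_closure hx.1, hx.2⟩
  have h2 := norm_sub_norm_le (l • f x) (F x)
  rw [norm_sub_rev, norm_smul, Real.norm_of_nonneg hl.le] at h2
  have := hFf x
  rw [bump_eq_zero (by linarith), zero_mul]

theorem integral_bump_smul {l : ℝ} (hl : 0 < l) (a : E) :
    ∫ x, bump E (l • (x - a)) * l ^ Module.finrank ℝ E = 1 := by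
  rw [integral_mul_const, integral_sub_right_eq_self (fun x => bump E (l • x)) a,
    Measure.integral_comp_smul, integral_bump, smul_eq_mul, mul_one, abs_of_pos (by positivity),
    inv_mul_cancel₀ (by positivity)]

theorem degree_sub_const {Ω : Set E} (hΩ : IsOpen Ω) (hb : IsBounded Ω) {a : E} (ha : a ∈ Ω) :
    degree (fun x => x - a) Ω = 1 := by
  obtain ⟨r, hr, hrΩ⟩ := Metric.isOpen_iff.1 hΩ a ha
  have hl : 0 < 3 / r := by positivity
  have hout : ∀ x ∉ Ω, 2 < 3 / r * ‖x - a‖ := fun x hx => by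
    have h1 : r ≤ ‖x - a‖ := by
      by_contra! h
      exact hx (hrΩ (by rwa [mem_ball, dist_eq_norm]))
    have := mul_le_mul_of_nonneg_left h1 hl.le
    rw [div_mul_cancel₀ _ hr.ne'] at this
    linarith
  rw [degree_eq hΩ hb (l := 3 / r) (g := fun x => (3 / r) • (x - a))
    ⟨hl, by fun_prop, fun x hx => ⟨hout x ?_, by simp⟩⟩]
  · have hfd : ∀ x, (fderiv ℝ (fun x : E => (3 / r) • (x - a)) x).det
        = (3 / r) ^ Module.finrank ℝ E := fun x => by
      have : HasFDerivAt (fun x : E => (3 / r) • (x - a))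
          ((3 / r) • ContinuousLinearMap.id ℝ E) x :=
        ((hasFDerivAt_id x).sub_const a).const_smul _
      rw [this.fderiv]
      simp [ContinuousLinearMap.det]
    unfold smoothDegree
    simp_rw [hfd]
    rw [setIntegral_eq_integral_of_forall_compl_eq_zero, integral_bump_smul hl]
    intro x hx
    have := hout x hx
    rw [bump_eq_zero, zero_mul]
    rw [norm_smul, Real.norm_of_nonneg hl.le]
    linarith
  · rw [hΩ.frontier_eq] at hx
    exact hx.2

/-- Maps that factor through a singular linear map have degree zero. -/
theorem degree_comp_singular {h k : E → E} (hh : Continuous h) (hk : Continuous k) (L : E →L[ℝ] E)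
    (hL : L.det = 0) {Ω : Set E} (hΩ : IsOpen Ω) (hb : IsBounded Ω)
    (h0 : ∀ x ∈ frontier Ω, k (L (h x)) ≠ 0) : degree (fun x => k (L (h x))) Ω = 0 := by
  obtain ⟨l, hl, hl'⟩ := exists_scale (hk.comp (L.continuous.comp hh))
    (isCompact_frontier_of_isBounded hb) h0
  obtain ⟨k', hk', hkk⟩ := exists_contDiff_near_smul hk l (ε := 1 / 2) (by norm_num)
  obtain ⟨h', hh', -, hhh⟩ := exists_contDiff_comp_near hh (k := fun y => l • k (L y))
    (by fun_prop) (isCompact_frontier_of_isBounded hb) (ε := 1 / 2) (by norm_num)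
  have hg : ContDiff ℝ 2 fun x => k' (L (h' x)) := hk'.comp (L.contDiff.comp hh')
  rw [degree_eq hΩ hb (l := l) (g := fun x => k' (L (h' x))) ⟨hl, hg, fun x hx => ⟨?_, ?_⟩⟩]
  · refine smoothDegree_eq_zero fun x hx => Or.inr ?_
    have := (hk'.differentiable two_ne_zero (L (h' x))).hasFDerivAt.comp x
      (L.hasFDerivAt.comp x (hh'.differentiable two_ne_zero x).hasFDerivAt)
    rw [HasFDerivAt.fderiv (f := fun x => k' (L (h' x))) this]
    rw [ContinuousLinearMap.det] at hL ⊢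
    simp [hL]
  · exact hl' l le_rfl x hx
  · have h1 := hkk (L (h' x))
    change ‖k' (L (h' x)) - l • k (L (h x))‖ ≤ 1
    have h2 := hhh x hx
    have h3 := norm_add_le (k' (L (h' x)) - l • k (L (h' x)))
      (l • k (L (h' x)) - l • k (L (h x)))
    rw [sub_add_sub_cancel] at h3
    linarith

end Degree

section ChangeOfVariables

variable {E : Type*} [NormedAddCommGroup E] [InnerProductSpace ℝ E] [FiniteDimensional ℝ E]

theorem exists_pos_le_norm_sub_add {f g : E → E} (hf : Continuous f) (hg : Continuous g)
    {A B : Set E} (hA : IsCompact A) (hB : IsClosed B) (h : ∀ x ∈ A, f x ∈ B → g (f x) ≠ 0) :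
    ∃ ε > 0, ∀ x ∈ A, ∀ y ∈ B, ε ≤ ‖f x - y‖ + ‖g y‖ := by
  have hK : IsCompact (A ×ˢ (B ∩ cthickening 1 (f '' A))) :=
    hA.prod ((hA.image hf).cthickening.inter_left hB)
  obtain ⟨δ, hδ, hδ'⟩ := hK.exists_pos_forall_le
    (φ := fun p => ‖f p.1 - p.2‖ + ‖g p.2‖) (by fun_prop) (fun p hp => by
      by_contra! hle
      have h1 : ‖f p.1 - p.2‖ = 0 := by
        linarith [norm_nonneg (f p.1 - p.2), norm_nonneg (g p.2)]
      have h2 : ‖g p.2‖ = 0 := by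
        linarith [norm_nonneg (f p.1 - p.2), norm_nonneg (g p.2)]
      have h3 : f p.1 = p.2 := sub_eq_zero.1 (norm_eq_zero.1 h1)
      refine h p.1 hp.1 (h3 ▸ hp.2.1) ?_
      rw [h3]
      exact norm_eq_zero.1 h2)
  refine ⟨min δ 1, by positivity, fun x hx y hy => ?_⟩
  by_cases hxy : ‖f x - y‖ ≤ 1
  · refine (min_le_left _ _).trans (hδ' (x, y) ⟨hx, hy, ?_⟩)
    refine mem_cthickening_of_dist_le y (f x) 1 _ (mem_image_of_mem f hx) ?_
    rwa [dist_comm, dist_eq_norm]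
  · push Not at hxy
    have := norm_nonneg (g y)
    have := min_le_right δ 1
    linarith

variable [MeasurableSpace E] [BorelSpace E]

theorem integral_bump_smul_left {l : ℝ} (hl : 0 < l) (a : E) :
    ∫ y, bump E (l • (a - y)) * l ^ Module.finrank ℝ E = 1 := by
  have := integral_bump_smul hl (0 : E)
  rw [← integral_sub_left_eq_self _ _ a] at this
  simpa using this

/-- The change of variables formula for the degree. -/
theorem setIntegral_comp_mul_det {f : E → E} (hf : ContDiff ℝ 2 f) {Ω : Set E}
    (hΩ : IsOpen Ω) (hb : IsBounded Ω) {η : E → ℝ} (hη : Continuous η) (hc : HasCompactSupport η)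
    (hbd : ∀ x ∈ frontier Ω, f x ∉ tsupport η) {d : ℝ}
    (hd : ∀ y ∈ tsupport η, degree (fun x => f x - y) Ω = d) :
    ∫ x in Ω, η (f x) * (fderiv ℝ f x).det = d * ∫ y, η y := by
  set N := Module.finrank ℝ E
  set T := tsupport η with hT
  have hTc : IsCompact T := hc
  have hη0 : ∀ y ∉ T, η y = 0 := fun y hy => image_eq_zero_of_notMem_tsupport hy
  have hdet := continuous_det_fderiv hf
  have hf0 := hf.continuous
  obtain ⟨δ, hδ, hδ'⟩ := ((isCompact_frontier_of_isBounded hb).prod hTc).exists_pos_forall_le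
    (φ := fun p => ‖f p.1 - p.2‖) (by fun_prop)
    (fun p hp => norm_pos_iff.2 fun h => hbd p.1 hp.1 (by
      rw [sub_eq_zero.1 h]; exact hp.2))
  have hbI : ∀ l : ℝ, 0 < l → ∀ y, ∫ x in Ω, bump E (l • (f x - y)) * (l ^ N *
      (fderiv ℝ f x).det) = smoothDegree (fun x => l • (f x - y)) Ω := fun l hl y => by
    unfold smoothDegree
    congr 1
    ext x
    have : HasFDerivAt (fun x : E => l • (f x - y)) (l • fderiv ℝ f x) x :=
      ((hf.differentiable two_ne_zero x).hasFDerivAt.sub_const y).const_smul _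
    rw [this.fderiv]
    simp [ContinuousLinearMap.det, N]
  have key : ∀ l : ℝ, 3 / δ ≤ l → d * ∫ y, η y = ∫ x in Ω,
      (∫ y, η y * (bump E (l • (f x - y)) * l ^ N)) * (fderiv ℝ f x).det := fun l hl => by
    have hl0 : 0 < l := lt_of_lt_of_le (by positivity) hl
    have h1 : ∀ y ∈ T, ∫ x in Ω, bump E (l • (f x - y)) * (l ^ N * (fderiv ℝ f x).det) = d :=
      fun y hy => by
        rw [hbI l hl0, ← hd y hy]
        refine (degree_eq hΩ hb (l := l) ⟨hl0, by fun_prop, fun x hx => ⟨?_, by simp⟩⟩).symm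
        have h1 : 3 / δ * δ ≤ l * ‖f x - y‖ := mul_le_mul hl (hδ' (x, y) ⟨hx, hy⟩) hδ.le hl0.le
        rw [div_mul_cancel₀ _ hδ.ne'] at h1
        linarith
    have hcont : Continuous (Function.uncurry fun (y x : E) =>
        η y * (bump E (l • (f x - y)) * (l ^ N * (fderiv ℝ f x).det))) := by
      refine (hη.comp continuous_fst).mul (Continuous.mul ?_ ?_)
      · exact continuous_bump.comp (by fun_prop)
      · exact continuous_const.mul (hdet.comp continuous_snd)
    have hint : Integrable (Function.uncurry fun (y x : E) =>
        η y * (bump E (l • (f x - y)) * (l ^ N * (fderiv ℝ f x).det)))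
        ((volume.restrict T).prod (volume.restrict Ω)) := by
      rw [Measure.prod_restrict]
      exact (hcont.continuousOn.integrableOn_compact (hTc.prod hb.isCompact_closure)).mono_set
        (Set.prod_mono le_rfl subset_closure)
    calc d * ∫ y, η y = ∫ y in T, η y * d := by
          rw [integral_mul_const, setIntegral_eq_integral_of_forall_compl_eq_zero hη0, mul_comm]
      _ = ∫ y in T, ∫ x in Ω, η y * (bump E (l • (f x - y)) * (l ^ N * (fderiv ℝ f x).det)) := by
          refine setIntegral_congr_fun hTc.measurableSet fun y hy => ?_
          simp only [integral_const_mul]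
          rw [h1 y hy]
      _ = ∫ x in Ω, ∫ y in T, η y * (bump E (l • (f x - y)) * (l ^ N * (fderiv ℝ f x).det)) :=
          integral_integral_swap hint
      _ = _ := by
          congr 1
          ext x
          rw [setIntegral_eq_integral_of_forall_compl_eq_zero (fun y hy => by simp [hη0 y hy]),
            ← integral_mul_const]
          congr 1
          ext y
          ring
  have hη_int : ∀ l : ℝ, ∀ a : E,
      Integrable fun y => η y * (bump E (l • (a - y)) * l ^ N) := fun l a => by
    refine Continuous.integrable_of_hasCompactSupport ?_ hc.mul_right
    exact hη.mul ((continuous_bump.comp (by fun_prop)).mul continuous_const)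
  have hb_int : ∀ l : ℝ, 0 < l → ∀ a : E,
      Integrable fun y => bump E (l • (a - y)) * l ^ N := fun l hl a => by
    by_contra h
    have := integral_bump_smul_left hl a
    rw [integral_undef h] at this
    exact zero_ne_one this
  have hLint : IntegrableOn (fun x => |(fderiv ℝ f x).det|) Ω :=
    (hdet.abs.continuousOn.integrableOn_compact hb.isCompact_closure).mono_set subset_closure
  set C := ∫ x in Ω, |(fderiv ℝ f x).det| with hC
  have hC0 : 0 ≤ C := integral_nonneg fun x => abs_nonneg _
  have happrox : ∀ ε > 0, |d * (∫ y, η y) - ∫ x in Ω, η (f x) * (fderiv ℝ f x).det| ≤ ε * C := by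
    intro ε hε
    obtain ⟨r, hr, hr'⟩ := Metric.uniformContinuous_iff.1
      (hc.uniformContinuous_of_continuous hη) ε hε
    set l := max (3 / δ) (1 / r) with hl
    have hl0 : 0 < l := lt_of_lt_of_le (by positivity : 0 < 3 / δ) (le_max_left _ _)
    have hlr : 1 ≤ l * r := by
      rw [← div_le_iff₀ hr]; exact le_max_right _ _
    have hin : ∀ a, |(∫ y, η y * (bump E (l • (a - y)) * l ^ N)) - η a| ≤ ε := fun a => by
      have h1 : (∫ y, η y * (bump E (l • (a - y)) * l ^ N)) - η a
          = ∫ y, (η y - η a) * (bump E (l • (a - y)) * l ^ N) := by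
        simp_rw [sub_mul]
        rw [integral_sub (hη_int l a) ((hb_int l hl0 a).const_mul _), integral_const_mul,
          integral_bump_smul_left hl0 a, mul_one]
      have h2 : ε = ∫ y, ε * (bump E (l • (a - y)) * l ^ N) := by
        rw [integral_const_mul, integral_bump_smul_left hl0 a, mul_one]
      rw [h1, h2, ← Real.norm_eq_abs]
      refine norm_integral_le_of_norm_le ((hb_int l hl0 a).const_mul _)
        (Eventually.of_forall fun y => ?_)
      have hnn : 0 ≤ bump E (l • (a - y)) * l ^ N := mul_nonneg (bump_nonneg _) (by positivity)
      rw [norm_mul, Real.norm_of_nonneg hnn]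
      by_cases hy : ‖l • (a - y)‖ < 1
      · refine mul_le_mul_of_nonneg_right ?_ hnn
        rw [← dist_eq_norm]
        refine (hr' ?_).le
        rw [dist_comm, dist_eq_norm]
        rw [norm_smul, Real.norm_of_nonneg hl0.le] at hy
        by_contra! hle
        nlinarith [mul_le_mul_of_nonneg_left hle hl0.le]
      · rw [bump_eq_zero (not_lt.1 hy)]
        simp
    have h1 : IntegrableOn (fun x => η (f x) * (fderiv ℝ f x).det) Ω :=
      (((hη.comp hf0).mul hdet).continuousOn.integrableOn_compact
        hb.isCompact_closure).mono_set subset_closure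
    have hm : Continuous fun a : E => ∫ y, η y * (bump E (l • (a - y)) * l ^ N) := by
      have hcc : Continuous (Function.uncurry fun (a y : E) =>
          η y * (bump E (l • (a - y)) * l ^ N)) :=
        (hη.comp continuous_snd).mul ((continuous_bump.comp (by fun_prop)).mul continuous_const)
      have hres := continuous_parametric_integral_of_continuous (μ := volume) hcc hTc
      have heq : ∀ a : E, ∫ y in T, η y * (bump E (l • (a - y)) * l ^ N)
          = ∫ y, η y * (bump E (l • (a - y)) * l ^ N) := fun a =>
        setIntegral_eq_integral_of_forall_compl_eq_zero fun y hy => by simp [hη0 y hy]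
      simpa only [heq] using hres
    have h2 : IntegrableOn (fun x => (∫ y, η y * (bump E (l • (f x - y)) * l ^ N)) *
        (fderiv ℝ f x).det) Ω :=
      (((hm.comp hf0).mul hdet).continuousOn.integrableOn_compact
        hb.isCompact_closure).mono_set subset_closure
    rw [key l (le_max_left _ _), ← integral_sub h2 h1, hC, ← integral_const_mul,
      ← Real.norm_eq_abs]
    refine norm_integral_le_of_norm_le (hLint.const_mul _) (Eventually.of_forall fun x => ?_)
    rw [← sub_mul, norm_mul, Real.norm_eq_abs, Real.norm_eq_abs]
    exact mul_le_mul_of_nonneg_right (hin (f x)) (abs_nonneg _)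
  have hle : |d * (∫ y, η y) - ∫ x in Ω, η (f x) * (fderiv ℝ f x).det| ≤ 0 := by
    refine le_of_forall_pos_le_add fun ε hε => ?_
    have h1 := happrox (ε / (C + 1)) (by positivity)
    have h2 : ε / (C + 1) * C ≤ ε := by
      rw [div_mul_eq_mul_div, div_le_iff₀ (by linarith)]
      nlinarith
    linarith
  have := abs_nonpos_iff.1 hle
  linarith

end ChangeOfVariables

section Composition

variable {E : Type*} [NormedAddCommGroup E] [InnerProductSpace ℝ E] [FiniteDimensional ℝ E]
  [MeasurableSpace E] [BorelSpace E]

/-- **Multiplicativity of the degree**: if `f` has constant degree `d` over `W`, and `W` contains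
all zeros of `g` that matter, then `deg (g ∘ f) = d * deg g`. -/
theorem degree_comp {f g : E → E} (hf : Continuous f) (hg : Continuous g) {Ω W : Set E}
    (hΩ : IsOpen Ω) (hb : IsBounded Ω) (hW : IsOpen W) (hWb : IsBounded W)
    (h1 : ∀ x ∈ frontier Ω, g (f x) ≠ 0) (h2 : ∀ y ∈ frontier W, g y ≠ 0)
    (h3 : ∀ x ∈ closure Ω, g (f x) = 0 → f x ∈ W) {d : ℝ}
    (hd : ∀ y ∈ W, degree (fun x => f x - y) Ω = d) :
    degree (fun x => g (f x)) Ω = d * degree g W := by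
  have hfr := isCompact_frontier_of_isBounded hb
  obtain ⟨ε₁, hε₁, hA⟩ := exists_pos_le_norm_sub_add hf hg hb.isCompact_closure hW.isClosed_compl
    (fun x hx hxW h0 => hxW (h3 x hx h0))
  obtain ⟨ε₂, hε₂, hB⟩ := exists_pos_le_norm_sub_add hf hg hfr isClosed_univ
    (fun x hx _ => h1 x hx)
  obtain ⟨ε₃, hε₃, hC⟩ := (isCompact_frontier_of_isBounded hWb).exists_pos_forall_le
    (φ := fun y => ‖g y‖) (by fun_prop) (fun y hy => norm_pos_iff.2 (h2 y hy))
  obtain ⟨ε, hε, hεA, hεB, hεC⟩ : ∃ ε > 0, ε ≤ ε₁ ∧ ε ≤ ε₂ ∧ ε ≤ ε₃ :=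
    ⟨min ε₁ (min ε₂ ε₃), by positivity, min_le_left _ _, (min_le_right _ _).trans (min_le_left _ _),
      (min_le_right _ _).trans (min_le_right _ _)⟩
  set l := 10 / ε with hl
  have hl0 : 0 < l := by positivity
  have hlε : l * ε = 10 := div_mul_cancel₀ _ hε.ne'
  obtain ⟨G, hG, hGg⟩ := exists_contDiff_near_smul hg l (ε := 1 / 2) (by norm_num)
  obtain ⟨F, hF, hFf, hFg⟩ := exists_contDiff_comp_near hf (k := fun y => l • g y)
    (by fun_prop) hb.isCompact_closure (ε := min (ε / 2) (1 / 2)) (by positivity)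
  have hFf' : ∀ x, ‖F x - f x‖ ≤ ε / 2 := fun x => (hFf x).trans (min_le_left _ _)
  have hGnorm : ∀ y, |‖G y‖ - l * ‖g y‖| ≤ 1 / 2 := fun y => by
    have := abs_norm_sub_norm_le (G y) (l • g y)
    rw [norm_smul, Real.norm_of_nonneg hl0.le] at this
    exact this.trans (hGg y)
  have hGF : ContDiff ℝ 2 fun x => G (F x) := hG.comp hF
  -- the degree of the composition
  have hcomp : degree (fun x => g (f x)) Ω = smoothDegree (fun x => G (F x)) Ω := by
    refine degree_eq hΩ hb (l := l) ⟨hl0, hGF, fun x hx => ⟨?_, ?_⟩⟩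
    · have := hB x hx (f x) trivial
      rw [sub_self, norm_zero, zero_add] at this
      have := mul_le_mul_of_nonneg_left (hεB.trans this) hl0.le
      simp only
      linarith
    · have e1 := hGg (F x)
      have e2 := (hFg x (frontier_subset_closure hx)).trans (min_le_right _ _)
      have e3 := norm_add_le (G (F x) - l • g (F x)) (l • g (F x) - l • g (f x))
      rw [sub_add_sub_cancel] at e3
      simp only
      linarith
  have hgW : degree g W = smoothDegree G W := by
    refine degree_eq hW hWb (l := l) ⟨hl0, hG, fun y hy => ⟨?_, by linarith [hGg y]⟩⟩
    have := mul_le_mul_of_nonneg_left (hεC.trans (hC y hy)) hl0.le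
    linarith
  -- the density to be pulled back
  set ζ : E → ℝ := fun y => bump E (G y) * (fderiv ℝ G y).det with hζ
  have hζc : Continuous ζ := (continuous_bump.comp hG.continuous).mul (continuous_det_fderiv hG)
  set η : E → ℝ := W.indicator ζ with hη
  set T : Set E := closure W ∩ {y | ‖G y‖ ≤ 1} with hT
  have hTclosed : IsClosed T :=
    isClosed_closure.inter (isClosed_le hG.continuous.norm continuous_const)
  have hTc : IsCompact T :=
    hWb.isCompact_closure.inter_right (isClosed_le hG.continuous.norm continuous_const)
  have hTg : ∀ y ∈ T, ‖g y‖ ≤ ε / 4 := fun y hy => by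
    have e1 := (abs_le.1 (hGnorm y)).1
    have e2 : ‖G y‖ ≤ 1 := hy.2
    by_contra! hlt
    have := mul_lt_mul_of_pos_left hlt hl0
    linarith
  have hTW : T ⊆ W := fun y hy => by
    by_contra hyW
    have : y ∈ frontier W := by rw [hW.frontier_eq]; exact ⟨hy.1, hyW⟩
    linarith [hC y this, hTg y hy]
  have hη0 : ∀ y ∉ T, η y = 0 := fun y hy => by
    by_cases hyW : y ∈ W
    · have : 1 ≤ ‖G y‖ := by
        by_contra! hlt
        exact hy ⟨subset_closure hyW, hlt.le⟩
      simp [hη, hyW, hζ, bump_eq_zero this]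
    · simp [hη, hyW]
  have hsupp : Function.support η ⊆ T := fun y hy => by
    by_contra h
    exact hy (hη0 y h)
  have hts : tsupport η ⊆ T := closure_minimal hsupp hTclosed
  have hηcs : HasCompactSupport η := HasCompactSupport.intro hTc hη0
  have hηc : Continuous η := by
    rw [continuous_iff_continuousAt]
    intro y
    by_cases hy : y ∈ T
    · refine hζc.continuousAt.congr ?_
      filter_upwards [hW.mem_nhds (hTW hy)] with z hz
      simp [hη, hz]
    · refine (continuousAt_const (y := (0 : ℝ))).congr ?_
      filter_upwards [hTclosed.isOpen_compl.mem_nhds hy] with z hz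
      exact (hη0 z hz).symm
  have hfar : ∀ x ∈ frontier Ω, ∀ y ∈ T, 3 * ε / 4 ≤ ‖f x - y‖ := fun x hx y hy => by
    linarith [hB x hx y trivial, hTg y hy]
  have hint : ∫ y, η y = smoothDegree G W := by
    rw [hη, integral_indicator hW.measurableSet]
    rfl
  have hmain := setIntegral_comp_mul_det hF hΩ hb hηc hηcs (d := d) (fun x hx hxT => by
      linarith [hfar x hx _ (hts hxT), hFf' x, norm_sub_rev (f x) (F x)])
    (fun y hy => by
      rw [← hd y (hTW (hts hy))]
      refine degree_congr (hF.continuous.sub continuous_const) (hf.sub continuous_const) hΩ hb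
        fun x hx t ht h0 => ?_
      change F x - y + t • (f x - y - (F x - y)) = 0 at h0
      have e1 : f x - y = (1 - t) • (f x - F x) := by
        have : f x - y = (1 - t) • (f x - F x) + (F x - y + t • (f x - y - (F x - y))) := by
          module
        rw [this, h0, add_zero]
      have e2 := hfar x hx y (hts hy)
      rw [e1, norm_smul, Real.norm_of_nonneg (sub_nonneg.2 ht.2), norm_sub_rev] at e2
      nlinarith [hFf' x, ht.1, norm_nonneg (F x - f x)])
  rw [hcomp, hgW, ← hint, ← hmain]
  unfold smoothDegree
  refine setIntegral_congr_fun hΩ.measurableSet fun x hx => ?_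
  have hfd : fderiv ℝ (fun x => G (F x)) x = (fderiv ℝ G (F x)).comp (fderiv ℝ F x) :=
    ((hG.differentiable two_ne_zero (F x)).hasFDerivAt.comp x
      (hF.differentiable two_ne_zero x).hasFDerivAt).fderiv
  have hdet : (fderiv ℝ (fun x => G (F x)) x).det
      = (fderiv ℝ G (F x)).det * (fderiv ℝ F x).det := by
    rw [hfd]; simp [ContinuousLinearMap.det]
  simp only [hdet]
  by_cases hy : F x ∈ W
  · simp only [hη, hy, indicator_of_mem, hζ]
    ring
  · have e1 := hA x (subset_closure hx) (F x) hy
    have e2 := hFf' x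
    rw [norm_sub_rev] at e1
    have e3 : ε / 2 ≤ ‖g (F x)‖ := by linarith
    have e4 := mul_le_mul_of_nonneg_left e3 hl0.le
    have e5 := (abs_le.1 (hGnorm (F x))).1
    rw [bump_eq_zero (by linarith)]
    simp [hη, hy]

end Composition

section Embeddings

variable {E : Type*} [NormedAddCommGroup E] [InnerProductSpace ℝ E] [FiniteDimensional ℝ E]

/-- A map that is constant on the fibres of a map from a compact space factors through a globally
defined continuous map. -/
theorem exists_continuous_factor {X : Type*} [TopologicalSpace X] [CompactSpace X] {φ ψ : X → E}
    (hφ : Continuous φ) (hψ : Continuous ψ) (h : ∀ a b, φ a = φ b → ψ a = ψ b) :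
    ∃ g : E → E, Continuous g ∧ ∀ x, g (φ x) = ψ x := by
  have : TietzeExtension E := TietzeExtension.of_tvs ℝ
  set g₀ : range φ → E := fun y => ψ y.2.choose with hg₀
  have hg₀φ : ∀ x, g₀ (rangeFactorization φ x) = ψ x := fun x =>
    h _ _ (rangeFactorization φ x).2.choose_spec
  have hq : IsQuotientMap (rangeFactorization φ) :=
    IsQuotientMap.of_surjective_continuous rangeFactorization_surjective
      hφ.rangeFactorization
  have hg₀c : Continuous g₀ := by
    rw [hq.continuous_iff]
    convert hψ using 1
    exact funext hg₀φ
  obtain ⟨g, hg⟩ := ContinuousMap.exists_restrict_eq (isCompact_range hφ).isClosed ⟨g₀, hg₀c⟩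
  refine ⟨g, g.continuous, fun x => ?_⟩
  have := DFunLike.congr_fun hg (rangeFactorization φ x)
  exact this.trans (hg₀φ x)

variable [MeasurableSpace E] [BorelSpace E]

/-- The image of a compact space under an embedding into `E` contains no ball if the space also
embeds into a proper subspace of `E`. -/
theorem not_closedBall_subset_range {X : Type*} [TopologicalSpace X] [CompactSpace X]
    {φ ψ : X → E} (hφ : Continuous φ) (hψ : Continuous ψ) (hφi : Function.Injective φ)
    (hψi : Function.Injective ψ) (L : E →L[ℝ] E) (hL : L.det = 0) (hLψ : ∀ x, L (ψ x) = ψ x)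
    (a : E) {r : ℝ} (hr : 0 < r) : ¬ closedBall a r ⊆ range φ := by
  intro hsub
  obtain ⟨h, hh, hhφ⟩ := exists_continuous_factor hφ hψ fun a b hab => by rw [hφi hab]
  obtain ⟨k, hk, hkψ⟩ := exists_continuous_factor hψ hφ fun a b hab => by rw [hψi hab]
  have hid : ∀ y ∈ closedBall a r, k (L (h y)) = y := fun y hy => by
    obtain ⟨x, rfl⟩ := hsub hy
    rw [hhφ, hLψ, hkψ]
  have hfr : ∀ y ∈ frontier (ball a r), k (L (h y)) = y ∧ y ≠ a := fun y hy => by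
    rw [frontier_ball a hr.ne'] at hy
    exact ⟨hid y (sphere_subset_closedBall hy), ne_of_mem_sphere hy hr.ne'⟩
  have h1 : degree (fun x => k (L (h x)) - a) (ball a r) = 0 :=
    degree_comp_singular hh (k := fun y => k y - a) (by fun_prop) L hL isOpen_ball isBounded_ball
      fun x hx => by rw [(hfr x hx).1]; exact sub_ne_zero.2 (hfr x hx).2
  have h2 : degree (fun x => k (L (h x)) - a) (ball a r) = degree (fun x => x - a) (ball a r) :=
    degree_congr_of_eqOn (by fun_prop) (by fun_prop) isOpen_ball isBounded_ball
      (fun x hx => by rw [(hfr x hx).1]; exact sub_ne_zero.2 (hfr x hx).2)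
      (fun x hx => by simp only [(hfr x hx).1])
  rw [h1, degree_sub_const isOpen_ball isBounded_ball (mem_ball_self hr)] at h2
  exact zero_ne_one h2

omit [FiniteDimensional ℝ E] [MeasurableSpace E] [BorelSpace E] in
theorem norm_sub_sq_of_unit {p q : E} (hp : ‖p‖ = 1) (hq : ‖q‖ = 1) :
    ‖p - q‖ ^ 2 = 2 - 2 * inner ℝ p q := by
  rw [norm_sub_sq_real, hp, hq]; ring

/-- A map of degree one of the sphere to itself that is the identity near `q` and collapses the
complement of a larger cap around `q` to the antipode of `q`. -/
theorem exists_collapse {q : E} (hq : ‖q‖ = 1) {ρ : ℝ} (hρ : 0 < ρ) :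
    ∃ c : E → E, Continuous c ∧ (∀ p, ‖p‖ = 1 → ‖c p‖ = 1) ∧
      (∀ p, ‖p‖ = 1 → ‖p - q‖ ≤ ρ → c p = p) ∧
      (∀ p, ‖p‖ = 1 → ‖p - q‖ ≤ ‖c p - q‖) ∧
      (∀ p, ‖p‖ = 1 → 2 * ρ ≤ ‖p - q‖ → c p = -q) ∧ degree c (ball 0 1) = 1 := by
  set s : E → ℝ := fun p => max 0 (min 1 (‖p - q‖ / ρ - 1)) with hs
  have hs0 : ∀ p, 0 ≤ s p := fun p => le_max_left _ _
  have hs1 : ∀ p, s p ≤ 1 := fun p => max_le zero_le_one (min_le_left _ _)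
  have hsc : Continuous s := by fun_prop
  have hsq : s q = 0 := by simp [hs]
  set u : E → E := fun p => (1 - s p) • p - s p • q with hu
  have huc : Continuous u := by fun_prop
  have hne : ∀ p, ‖p‖ = 1 → ∀ t ∈ Icc (0 : ℝ) 1, (1 - t * s p) • p - (t * s p) • q ≠ 0 :=
    fun p hp t ht h0 => by
      have h1 : (1 - t * s p) • p = (t * s p) • q := sub_eq_zero.1 h0
      have ha : 0 ≤ t * s p := mul_nonneg ht.1 (hs0 p)
      have hb : t * s p ≤ 1 := mul_le_one₀ ht.2 (hs0 p) (hs1 p)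
      have h2 := congrArg norm h1
      rw [norm_smul, norm_smul, Real.norm_of_nonneg ha, Real.norm_of_nonneg (sub_nonneg.2 hb), hp,
        hq] at h2
      have h3 : t * s p = 1 / 2 := by linarith
      rw [h3] at h1
      have h4 : p = q := by
        rw [show (1 - 1 / 2 : ℝ) = 1 / 2 by norm_num] at h1
        exact smul_right_injective E (show (1 / 2 : ℝ) ≠ 0 by norm_num) h1
      rw [h4, hsq] at h3
      norm_num at h3
  have hu0 : ∀ p, ‖p‖ = 1 → u p ≠ 0 := fun p hp => by
    simpa [hu] using hne p hp 1 (by simp)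
  set c₀ : sphere (0 : E) 1 → E := fun p => ‖u p‖⁻¹ • u p with hc₀
  have hc₀c : Continuous c₀ := by
    refine Continuous.smul (Continuous.inv₀ (by fun_prop) fun p => ?_) (by fun_prop)
    exact norm_ne_zero_iff.2 (hu0 p (by simp))
  obtain ⟨c, hc, hcc⟩ := exists_continuous_factor (continuous_subtype_val) hc₀c
    (fun a b hab => by rw [Subtype.ext hab])
  have hcu : ∀ p, ‖p‖ = 1 → c p = ‖u p‖⁻¹ • u p := fun p hp => hcc ⟨p, by simpa using hp⟩
  have hcn : ∀ p, ‖p‖ = 1 → ‖c p‖ = 1 := fun p hp => by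
    rw [hcu p hp, norm_smul, norm_inv, norm_norm,
      inv_mul_cancel₀ (norm_ne_zero_iff.2 (hu0 p hp))]
  refine ⟨c, hc, hcn, fun p hp hpq => ?_, fun p hp => ?_, fun p hp hpq => ?_, ?_⟩
  · have : s p = 0 := by
      refine max_eq_left ((min_le_right _ _).trans ?_)
      rw [sub_nonpos, div_le_one hρ]; exact hpq
    rw [hcu p hp]
    simp [hu, this, hp]
  · have hpos : 0 < ‖u p‖ := norm_pos_iff.2 (hu0 p hp)
    have h1 : inner ℝ (c p) q ≤ inner ℝ p q := by
      rw [hcu p hp, real_inner_smul_left, inv_mul_le_iff₀ hpos]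
      have h2 : inner ℝ (u p) q = (1 - s p) * inner ℝ p q - s p := by
        simp [hu, inner_sub_left, real_inner_smul_left, hq]
      have h3 := real_inner_le_norm p q
      have h3' := neg_le_of_abs_le (abs_real_inner_le_norm p q)
      rw [hp, hq, one_mul] at h3 h3'
      have h4 : ‖u p‖ ≤ 1 := by
        refine (norm_sub_le _ _).trans ?_
        rw [norm_smul, norm_smul, Real.norm_of_nonneg (hs0 p),
          Real.norm_of_nonneg (sub_nonneg.2 (hs1 p)), hp, hq]
        linarith
      have h5 : (1 - s p) - s p ≤ ‖u p‖ := by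
        have := norm_sub_norm_le ((1 - s p) • p) (s p • q)
        rwa [norm_smul, norm_smul, Real.norm_of_nonneg (hs0 p),
          Real.norm_of_nonneg (sub_nonneg.2 (hs1 p)), hp, hq, mul_one, mul_one] at this
      rw [h2]
      rcases le_total 0 (inner ℝ p q) with h6 | h6
      · nlinarith [mul_le_mul_of_nonneg_right h5 h6, mul_nonneg (hs0 p) (sub_nonneg.2 h3)]
      · nlinarith [mul_le_mul_of_nonpos_right h4 h6, mul_nonneg (hs0 p)
          (sub_nonneg.2 h3')]
    have h2 := norm_sub_sq_of_unit (hcn p hp) hq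
    have h3 := norm_sub_sq_of_unit hp hq
    exact le_of_sq_le_sq (by linarith) (norm_nonneg _)
  · have : s p = 1 := by
      have h1 : 2 ≤ ‖p - q‖ / ρ := by rwa [le_div_iff₀ hρ]
      have : min 1 (‖p - q‖ / ρ - 1) = 1 := min_eq_left (by linarith)
      simp [hs, this]
    rw [hcu p hp]
    simp [hu, this, hq]
  · have hfr : ∀ x ∈ frontier (ball (0 : E) 1), ‖x‖ = 1 := fun x hx => by
      rw [frontier_ball _ one_ne_zero] at hx
      simpa using hx
    refine Eq.trans ?_
      (degree_sub_const isOpen_ball isBounded_ball (mem_ball_self one_pos : (0 : E) ∈ ball 0 1))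
    trans degree u (ball 0 1)
    · refine (degree_congr huc hc isOpen_ball isBounded_ball fun x hx t ht => ?_).symm
      rw [hcu x (hfr x hx)]
      have hpos : 0 < ‖u x‖⁻¹ := inv_pos.2 (norm_pos_iff.2 (hu0 x (hfr x hx)))
      have : u x + t • (‖u x‖⁻¹ • u x - u x) = ((1 - t) + t * ‖u x‖⁻¹) • u x := by module
      rw [this]
      refine smul_ne_zero (ne_of_gt ?_) (hu0 x (hfr x hx))
      rcases eq_or_lt_of_le ht.1 with h0 | h0
      · subst h0; norm_num
      · have := mul_pos h0 hpos
        linarith [ht.2]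
    · refine (degree_congr (by fun_prop) huc isOpen_ball isBounded_ball fun x hx t ht => ?_).symm
      convert! hne x (hfr x hx) t ht using 1
      simp only [hu]
      module

end Embeddings

section NonconstantDegree

variable {E : Type*} [NormedAddCommGroup E] [InnerProductSpace ℝ E] [FiniteDimensional ℝ E]
  [MeasurableSpace E] [BorelSpace E]

/-- Near an injectivity point, the degree of an extension of a map of the sphere to the ball is not
constant off the image of the sphere. -/
theorem exists_degree_ne {k : E → E} (hk : Continuous k) {q : E} (hq : ‖q‖ = 1) {r : ℝ} (hr : 0 < r)
    (hinj : ∀ p p', ‖p‖ = 1 → ‖p'‖ = 1 → ‖p - q‖ < r → k p' = k p → p' = p) {ε : ℝ} (hε : 0 < ε)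
    (d : ℝ) : ∃ y ∈ ball (k q) ε, y ∉ k '' sphere 0 1 ∧
      degree (fun x => k x - y) (ball 0 1) ≠ d := by
  by_contra! hcon
  obtain ⟨δ, hδ, hδ'⟩ := Metric.continuousAt_iff.1 hk.continuousAt ε hε
  set ρ := min r δ / 2 with hρ
  have hρ0 : 0 < ρ := by positivity
  have hρr : 2 * ρ ≤ r := by rw [hρ]; linarith [min_le_left r δ]
  have hρδ : 2 * ρ ≤ δ := by rw [hρ]; linarith [min_le_right r δ]
  obtain ⟨c, hc, hc1, -, -, hcq, hcd⟩ := exists_collapse hq hρ0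
  obtain ⟨R, hR⟩ := ((isCompact_closedBall (0 : E) 1).image hk).isBounded.subset_closedBall (k q)
  set R' := max R ε with hR'
  set Sh : Set E := closedBall (k q) R' \ ball (k q) ε with hSh
  have hShc : IsCompact Sh := (isCompact_closedBall _ _).diff isOpen_ball
  have : CompactSpace Sh := isCompact_iff_compactSpace.1 hShc
  set φ : sphere (0 : E) 1 ⊕ Sh → E := Sum.elim (fun p => k p) (fun y => y) with hφ
  set ψ : sphere (0 : E) 1 ⊕ Sh → E := Sum.elim (fun p => c p) (fun _ => -q) with hψ
  have hfar : ∀ p, ‖p‖ = 1 → k p ∉ ball (k q) ε → c p = -q := fun p hp hpk =>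
    hcq p hp (by
      by_contra! hlt
      exact hpk (hδ' (by rw [dist_eq_norm]; linarith)))
  have hfib : ∀ a b, φ a = φ b → ψ a = ψ b := by
    rintro (⟨a, ha⟩ | ⟨a, ha⟩) (⟨b, hb⟩ | ⟨b, hb⟩) hab <;> simp only [hφ, hψ, Sum.elim_inl,
      Sum.elim_inr] at hab ⊢
    · rw [mem_sphere_zero_iff_norm] at ha hb
      by_cases h1 : ‖a - q‖ < 2 * ρ
      · rw [hinj a b ha hb (by linarith) hab.symm]
      · by_cases h2 : ‖b - q‖ < 2 * ρ
        · rw [hinj b a hb ha (by linarith) hab]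
        · rw [hcq a ha (not_lt.1 h1), hcq b hb (not_lt.1 h2)]
    · exact hfar a (by simpa using ha) (by rw [hab]; exact hb.2)
    · exact (hfar b (by simpa using hb) (by rw [← hab]; exact ha.2)).symm
  obtain ⟨g, hg, hgφ⟩ := exists_continuous_factor (φ := φ) (ψ := ψ) (by fun_prop) (by fun_prop) hfib
  have hgS : ∀ p, ‖p‖ = 1 → g (k p) = c p := fun p hp => hgφ (Sum.inl ⟨p, by simpa using hp⟩)
  have hgSh : ∀ y ∈ Sh, g y = -q := fun y hy => hgφ (Sum.inr ⟨y, hy⟩)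
  have hq0 : -q ≠ 0 := neg_ne_zero.2 (norm_ne_zero_iff.1 (by rw [hq]; exact one_ne_zero))
  have hc0 : ∀ p, ‖p‖ = 1 → c p ≠ 0 := fun p hp =>
    norm_ne_zero_iff.1 (by rw [hc1 p hp]; exact one_ne_zero)
  have hfr : ∀ x ∈ frontier (ball (0 : E) 1), ‖x‖ = 1 := fun x hx => by
    rw [frontier_ball _ one_ne_zero] at hx
    simpa using hx
  set K := k '' sphere (0 : E) 1 with hK
  have hKc : IsClosed K := ((isCompact_sphere _ _).image hk).isClosed
  set W := ball (k q) ε \ K with hW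
  have hWo : IsOpen W := isOpen_ball.sdiff hKc
  have hWb : IsBounded W := isBounded_ball.subset sdiff_subset
  have hz : ∀ y ∈ closedBall (k q) R', y ∉ W → g y ≠ 0 := fun y hy hyW => by
    by_cases hyb : y ∈ ball (k q) ε
    · have : y ∈ K := by_contra fun h => hyW ⟨hyb, h⟩
      obtain ⟨p, hp, rfl⟩ := this
      rw [hgS p (by simpa using hp)]
      exact hc0 p (by simpa using hp)
    · rw [hgSh y ⟨hy, hyb⟩]
      exact hq0
  have hcl : closure (ball (k q) ε) ⊆ closedBall (k q) R' :=
    closure_ball_subset_closedBall.trans (closedBall_subset_closedBall (le_max_right _ _))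
  have h1 := degree_comp hk hg (Ω := ball 0 1) (W := W) isOpen_ball isBounded_ball hWo hWb
    (fun x hx => by rw [hgS x (hfr x hx)]; exact hc0 x (hfr x hx))
    (fun y hy => by
      rw [hWo.frontier_eq] at hy
      exact hz y (hcl (closure_mono sdiff_subset hy.1)) hy.2)
    (fun x hx h0 => by
      by_contra hxW
      refine hz (k x) ?_ hxW h0
      rw [closure_ball _ one_ne_zero] at hx
      exact closedBall_subset_closedBall (le_max_left _ _) (hR (mem_image_of_mem k hx)))
    (d := d) (fun y hy => hcon y hy.1 hy.2)
  have h2 : degree (fun x => g (k x)) (ball 0 1) = 1 := by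
    refine (degree_congr_of_eqOn (by fun_prop) hc isOpen_ball isBounded_ball ?_ fun x hx =>
      hgS x (hfr x hx)).trans hcd
    intro x hx
    rw [hgS x (hfr x hx)]
    exact hc0 x (hfr x hx)
  have h3 : degree g W = 0 := by
    rw [← degree_excision hg isOpen_ball isBounded_ball hWo sdiff_subset
      fun y hy => hz y (hcl hy.1) hy.2]
    have hfrb : ∀ y ∈ frontier (ball (k q) ε), g y = -q := fun y hy => by
      rw [isOpen_ball.frontier_eq] at hy
      exact hgSh y ⟨hcl hy.1, hy.2⟩
    rw [degree_congr_of_eqOn hg (g := fun _ => -q) continuous_const isOpen_ball isBounded_ball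
      (fun y hy => by rw [hfrb y hy]; exact hq0) hfrb]
    exact degree_eq_zero continuous_const isOpen_ball isBounded_ball fun _ _ => hq0
  rw [h2, h3, mul_zero] at h1
  exact one_ne_zero h1

end NonconstantDegree

section TwoSides

variable {E : Type*} [NormedAddCommGroup E] [InnerProductSpace ℝ E] [FiniteDimensional ℝ E]
  [MeasurableSpace E] [BorelSpace E]

/-- A vector field with exactly two zeros inside a ball, of local degree one at the first of them,
which points to a fixed side outside of the ball. -/
theorem exists_two_zeros {c x z : E} {ε : ℝ} (hx : x ∈ ball c ε) (hz : z ∈ ball c ε) (hxz : x ≠ z) :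
    ∃ P : E → E, Continuous P ∧ (∀ u, P u = 0 → u = x ∨ u = z) ∧
      (∀ u, ε ≤ ‖u - c‖ → inner ℝ (P u) (z - x) < 0) ∧
      ∀ Ω : Set E, IsOpen Ω → IsBounded Ω → x ∈ Ω → z ∉ closure Ω → degree P Ω = 1 := by
  set v := z - x with hv
  have hv0 : v ≠ 0 := sub_ne_zero.2 hxz.symm
  have hvn : 0 < ‖v‖ := norm_pos_iff.2 hv0
  have hvv : (0 : ℝ) < ‖v‖ ^ 2 := by positivity
  rw [mem_ball, dist_eq_norm] at hx hz
  obtain ⟨r, hr, hrε⟩ := exists_between (max_lt hx hz)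
  have hxr : ‖x - c‖ < r := (le_max_left _ _).trans_lt hr
  have hzr : ‖z - c‖ < r := (le_max_right _ _).trans_lt hr
  set T := 1 / (ε - r) with hT
  have hT0 : 0 < T := one_div_pos.2 (sub_pos.2 hrε)
  set s : E → ℝ := fun u => inner ℝ (u - x) v / ‖v‖ ^ 2 with hs
  set μ : E → ℝ := fun u => max 0 (‖u - c‖ - r) with hμ
  have hsc : Continuous s := by fun_prop
  have hμc : Continuous μ := by fun_prop
  have hμ0 : ∀ u, 0 ≤ μ u := fun u => le_max_left _ _
  have hμr : ∀ u, ‖u - c‖ ≤ r → μ u = 0 := fun u hu => max_eq_left (sub_nonpos.2 hu)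
  set P : E → E := fun u => u - x - (s u ^ 2 + T * μ u) • v with hP
  have hPc : Continuous P := by fun_prop
  have hsv : ∀ u τ, u = x + τ • v → s u = τ := fun u τ hu => by
    rw [hs, hu]
    simp only [add_sub_cancel_left, real_inner_smul_left, real_inner_self_eq_norm_sq]
    rw [mul_div_assoc, div_self hvv.ne', mul_one]
  have hin : ∀ u, inner ℝ (P u) v = (s u - s u ^ 2 - T * μ u) * ‖v‖ ^ 2 := fun u => by
    simp only [hP, inner_sub_left (u - x), real_inner_smul_left, real_inner_self_eq_norm_sq]
    have : inner ℝ (u - x) v = s u * ‖v‖ ^ 2 := by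
      rw [hs]; exact (div_mul_cancel₀ _ hvv.ne').symm
    rw [this]; ring
  have hzero : ∀ u, P u = 0 → u = x ∨ u = z := fun u hu => by
    have h1 : u = x + (s u ^ 2 + T * μ u) • v := by
      have : u - x = (s u ^ 2 + T * μ u) • v := sub_eq_zero.1 hu
      rw [← this]; abel
    have h2 := hsv u _ h1
    have h3 : 0 ≤ T * μ u := mul_nonneg hT0.le (hμ0 u)
    have h4 : 0 ≤ s u := by rw [h2]; positivity
    have h5 : s u ≤ 1 := by nlinarith
    have h6 : ‖u - c‖ ≤ r := by
      have h7 : u - c = (1 - s u) • (x - c) + s u • (z - c) := by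
        rw [← h2] at h1
        nth_rewrite 1 [h1]
        rw [hv]; module
      rw [h7]
      refine (norm_add_le _ _).trans ?_
      rw [norm_smul, norm_smul, Real.norm_of_nonneg h4, Real.norm_of_nonneg (sub_nonneg.2 h5)]
      nlinarith
    rw [hμr u h6, mul_zero, add_zero] at h2 h1
    have h7 : s u * (s u - 1) = 0 := by linarith
    rcases mul_eq_zero.1 h7 with h8 | h8
    · left; rw [h1, h8]; simp
    · right; rw [h1, show s u = 1 by linarith, hv]; simp
  refine ⟨P, hPc, hzero, fun u hu => ?_, fun Ω hΩ hb hxΩ hzΩ => ?_⟩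
  · rw [hin]
    refine mul_neg_of_neg_of_pos ?_ hvv
    have h1 : ε - r ≤ μ u := le_trans (by linarith) (le_max_right _ _)
    have h2 : 1 ≤ T * μ u := by
      rw [hT, one_div_mul_eq_div, le_div_iff₀ (sub_pos.2 hrε)]; linarith
    nlinarith [sq_nonneg (s u - 1 / 2)]
  · obtain ⟨δ, hδ, hδΩ⟩ := Metric.isOpen_iff.1 hΩ x hxΩ
    set t := min (δ / 2) (min (‖v‖ / 2) (r - ‖x - c‖)) with ht
    have ht0 : 0 < t := by
      have := sub_pos.2 hxr
      positivity
    have htδ : t < δ := (min_le_left _ _).trans_lt (by linarith)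
    have htv : t < ‖v‖ := ((min_le_right _ _).trans (min_le_left _ _)).trans_lt (by linarith)
    have htr : t ≤ r - ‖x - c‖ := (min_le_right _ _).trans (min_le_right _ _)
    have hsub : ball x t ⊆ Ω := (ball_subset_ball htδ.le).trans hδΩ
    rw [degree_excision hPc hΩ hb isOpen_ball hsub fun u hu h0 => ?_]
    · rw [← degree_sub_const (a := x) isOpen_ball isBounded_ball (mem_ball_self ht0)]
      refine degree_congr hPc (by fun_prop) isOpen_ball isBounded_ball fun u hu w hw h0 => ?_
      rw [frontier_ball _ ht0.ne', mem_sphere, dist_eq_norm] at hu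
      have hμu : μ u = 0 := by
        refine hμr u ?_
        have := norm_add_le (u - x) (x - c)
        rw [sub_add_sub_cancel] at this
        linarith
      have h1 : u = x + ((1 - w) * s u ^ 2) • v := by
        have : P u + w • (u - x - P u) = u - x - ((1 - w) * s u ^ 2) • v := by
          simp only [hP, hμu]; module
        rw [this] at h0
        rw [← sub_eq_zero.1 h0]; abel
      have h2 := hsv u _ h1
      have h3 : 0 ≤ s u := by rw [h2]; exact mul_nonneg (sub_nonneg.2 hw.2) (sq_nonneg _)
      rw [← h2] at h1
      have h4 : s u * ‖v‖ = t := by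
        rw [← hu]
        nth_rewrite 2 [h1]
        rw [add_sub_cancel_left, norm_smul, Real.norm_of_nonneg h3]
      have h5 : s u < 1 := by
        by_contra! h
        nlinarith
      have h6 : s u = 0 := by
        by_contra hne
        have h7 : 0 < s u := lt_of_le_of_ne h3 (Ne.symm hne)
        nlinarith [mul_nonneg hw.1 (sq_nonneg (s u)), mul_pos h7 (sub_pos.2 h5)]
      rw [h6, zero_mul] at h4
      exact ht0.ne h4
    · rcases hzero u h0 with rfl | rfl
      · exact hu.2 (mem_ball_self ht0)
      · exact hzΩ hu.1

/-- Near an injectivity point, the complement of the image of the sphere meets at most two of any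
family of pieces. -/
theorem exists_ball_no_three {k : E → E} (hk : Continuous k) {q : E} (hq : ‖q‖ = 1)
    {r : ℝ} (hr : 0 < r)
    (hinj : ∀ p p', ‖p‖ = 1 → ‖p'‖ = 1 → ‖p - q‖ < r → k p' = k p → p' = p) :
    ∃ ε > 0, ∀ Ω₁ Ω₂ : Set E, IsOpen Ω₁ → IsOpen Ω₂ → IsBounded Ω₁ → IsBounded Ω₂ →
      Disjoint Ω₁ Ω₂ → frontier Ω₁ ⊆ k '' sphere 0 1 → frontier Ω₂ ⊆ k '' sphere 0 1 →
      ∀ x ∈ Ω₁, ∀ y ∈ Ω₂, ∀ z, z ∉ Ω₁ → z ∉ Ω₂ → x ∉ k '' sphere 0 1 → y ∉ k '' sphere 0 1 →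
      z ∉ k '' sphere 0 1 → x ∈ ball (k q) ε → y ∈ ball (k q) ε → z ∈ ball (k q) ε → False := by
  set K := k '' sphere (0 : E) 1 with hK
  set ρ := r / 2 with hρ
  have hρ0 : 0 < ρ := by positivity
  have hS : ∀ p : E, ‖p‖ = 1 ↔ p ∈ sphere (0 : E) 1 := fun p => mem_sphere_zero_iff_norm.symm
  obtain ⟨c, hc, hc1, hcid, hcfar, hcq, -⟩ := exists_collapse hq hρ0
  -- the part of the sphere away from `q` is mapped away from `k q`
  obtain ⟨ε, hε, hεfar⟩ := ((isCompact_sphere (0 : E) 1).diff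
    (isOpen_ball (x := q) (ε := ρ))).exists_pos_forall_le (φ := fun p => ‖k p - k q‖)
    (by fun_prop) (fun p hp => norm_pos_iff.2 (sub_ne_zero.2 fun h => by
      have := hinj q p hq ((hS p).2 hp.1) (by simpa using hr) h
      exact hp.2 (by rw [this]; exact mem_ball_self hρ0)))
  have hεfar' : ∀ p, ‖p‖ = 1 → ρ ≤ ‖p - q‖ → ε ≤ ‖k p - k q‖ := fun p hp hpq =>
    hεfar p ⟨(hS p).1 hp, by rw [mem_ball, dist_eq_norm]; exact not_lt.2 hpq⟩
  -- the approximate inverse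
  obtain ⟨g₀, hg₀, hg₀k⟩ := exists_continuous_factor (X := sphere (0 : E) 1)
    (φ := fun p => k p) (ψ := fun p => c p) (by fun_prop) (by fun_prop) (fun a b hab => by
      have ha := (hS _).2 a.2
      have hb := (hS _).2 b.2
      by_cases h1 : ‖(a : E) - q‖ < 2 * ρ
      · rw [hinj a b ha hb (by linarith) hab.symm]
      · by_cases h2 : ‖(b : E) - q‖ < 2 * ρ
        · rw [hinj b a hb ha (by linarith) hab]
        · simp only [hcq a ha (not_lt.1 h1), hcq b hb (not_lt.1 h2)])
  set g : E → E := fun y => (max 1 ‖g₀ y‖)⁻¹ • g₀ y with hg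
  have hmax : ∀ y, (0 : ℝ) < max 1 ‖g₀ y‖ := fun y => lt_of_lt_of_le one_pos (le_max_left _ _)
  have hgc : Continuous g := by
    refine Continuous.smul (Continuous.inv₀ (by fun_prop) fun y => (hmax y).ne') hg₀
  have hg1 : ∀ y, ‖g y‖ ≤ 1 := fun y => by
    simp only [hg]
    rw [norm_smul, norm_inv, Real.norm_of_nonneg (hmax y).le, inv_mul_le_iff₀ (hmax y), mul_one]
    exact le_max_right _ _
  have hgk : ∀ p, ‖p‖ = 1 → g (k p) = c p := fun p hp => by
    have := hg₀k ⟨p, (hS p).1 hp⟩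
    simp only at this
    simp [hg, this, hc1 p hp]
  have hKg : ∀ y ∈ K, ‖g y‖ = 1 := fun y hy => by
    obtain ⟨p, hp, rfl⟩ := hy
    rw [hgk p ((hS p).2 hp), hc1 p ((hS p).2 hp)]
  have hfr : ∀ x ∈ frontier (ball (0 : E) 1), ‖x‖ = 1 := fun x hx => by
    rw [frontier_ball _ one_ne_zero] at hx
    simpa using hx
  -- the product formula for a two-point field
  have hprod : ∀ P : E → E, Continuous P → ∀ x z : E, (∀ u, P u = 0 → u = x ∨ u = z) →
      (∀ u, ε ≤ ‖u - k q‖ → inner ℝ (P u) (z - x) < 0) → x ∉ K → z ∉ K →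
      ∀ Ω : Set E, IsOpen Ω → IsBounded Ω → frontier Ω ⊆ K →
      degree P Ω = degree g Ω * degree (fun u => P (k u)) (ball 0 1) := by
    intro P hP x z hP0 hPin hxK hzK Ω hΩ hb hfΩ
    have hPK : ∀ y ∈ K, P y ≠ 0 := fun y hy h0 => by
      rcases hP0 y h0 with rfl | rfl
      · exact hxK hy
      · exact hzK hy
    have hPkS : ∀ p, ‖p‖ = 1 → P (k p) ≠ 0 := fun p hp =>
      hPK _ (mem_image_of_mem k ((hS p).1 hp))
    rw [← degree_comp (g := fun u => P (k u)) hgc (by fun_prop) hΩ hb isOpen_ball isBounded_ball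
      (fun y hy => hPkS _ (hKg y (hfΩ hy))) (fun p hp => hPkS p (hfr p hp))
      (fun y hy h0 => by
        rw [mem_ball_zero_iff]
        exact lt_of_le_of_ne (hg1 y) fun h1 => hPkS _ h1 h0)
      (d := degree g Ω) (fun y hy => ?_)]
    · refine degree_congr hP (by fun_prop) hΩ hb fun y hy t ht => ?_
      obtain ⟨p, hp, rfl⟩ := hfΩ hy
      have hp1 := (hS p).2 hp
      simp only [hgk p hp1]
      by_cases hpq : ‖p - q‖ ≤ ρ
      · rw [hcid p hp1 hpq]
        simpa using hPkS p hp1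
      · push Not at hpq
        have h1 := hPin _ (hεfar' p hp1 hpq.le)
        have h2 := hPin _ (hεfar' (c p) (hc1 p hp1) (hpq.le.trans (hcfar p hp1)))
        intro h0
        have h3 : inner ℝ (P (k p) + t • (P (k (c p)) - P (k p))) (z - x) = 0 := by
          rw [h0, inner_zero_left]
        rw [inner_add_left, real_inner_smul_left, inner_sub_left (P (k (c p)))] at h3
        rcases eq_or_lt_of_le ht.1 with h4 | h4
        · subst h4; linarith
        · nlinarith [mul_pos_of_neg_of_neg (neg_lt_zero.2 h4) h2, ht.2]
    · refine degree_congr (by fun_prop) hgc hΩ hb fun u hu t ht h0 => ?_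
      have h1 : g u - y + t • (g u - (g u - y)) = g u - (1 - t) • y := by module
      rw [h1] at h0
      have h2 := congrArg norm (sub_eq_zero.1 h0)
      rw [hKg u (hfΩ hu), norm_smul, Real.norm_of_nonneg (sub_nonneg.2 ht.2)] at h2
      rw [mem_ball_zero_iff] at hy
      nlinarith [ht.1, norm_nonneg y]
  refine ⟨ε, hε, fun Ω₁ Ω₂ h₁ h₂ hb₁ hb₂ hdis hf₁ hf₂ x hx y hy z hz₁ hz₂ hxK hyK hzK hxε hyε hzε
    => ?_⟩
  have hz₁' : z ∉ closure Ω₁ := fun h => hzK (hf₁ (by rw [h₁.frontier_eq]; exact ⟨h, hz₁⟩))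
  have hz₂' : z ∉ closure Ω₂ := fun h => hzK (hf₂ (by rw [h₂.frontier_eq]; exact ⟨h, hz₂⟩))
  have hx₂ : x ∉ closure Ω₂ := fun h => hxK (hf₂ (by
    rw [h₂.frontier_eq]; exact ⟨h, fun h' => hdis.le_bot ⟨hx, h'⟩⟩))
  obtain ⟨P, hP, hP0, hPin, hPd⟩ := exists_two_zeros hxε hzε (by rintro rfl; exact hz₁ hx)
  obtain ⟨P', hP', hP0', hPin', hPd'⟩ := exists_two_zeros hyε hzε (by rintro rfl; exact hz₂ hy)
  have e1 := hprod P hP x z hP0 hPin hxK hzK Ω₁ h₁ hb₁ hf₁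
  rw [hPd Ω₁ h₁ hb₁ hx hz₁'] at e1
  have e2 := hprod P hP x z hP0 hPin hxK hzK Ω₂ h₂ hb₂ hf₂
  rw [degree_eq_zero hP h₂ hb₂ fun u hu h0 => by
    rcases hP0 u h0 with rfl | rfl
    · exact hx₂ hu
    · exact hz₂' hu] at e2
  have e3 := hprod P' hP' y z hP0' hPin' hyK hzK Ω₂ h₂ hb₂ hf₂
  rw [hPd' Ω₂ h₂ hb₂ hy hz₂'] at e3
  rcases mul_eq_zero.1 e2.symm with h | h
  · rw [h, zero_mul] at e3
    exact one_ne_zero e3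
  · rw [h, mul_zero] at e1
    exact one_ne_zero e1

end TwoSides

section PuncturedCharts

variable {E : Type*} [NormedAddCommGroup E] [InnerProductSpace ℝ E] [FiniteDimensional ℝ E]
  [MeasurableSpace E] [BorelSpace E]
variable {X : Type*} [TopologicalSpace X]

variable {a : X} {σ : OpenPartialHomeomorph X E}

omit [InnerProductSpace ℝ E] [MeasurableSpace E] [BorelSpace E] [FiniteDimensional ℝ E] in
/-- The coordinates of a punctured chart tend to infinity at the puncture. -/
theorem eventually_apply_notMem [T2Space X] (hs : σ.source = {a}ᶜ)
    (ht : σ.target = univ) {B : Set E} (hB : IsCompact B) :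
    ∀ᶠ s in 𝓝 a, s ≠ a → σ s ∉ B := by
  have h1 : IsCompact (σ.symm '' B) := hB.image_of_continuousOn
    (σ.continuousOn_symm.mono (by rw [ht]; exact subset_univ _))
  have h2 : a ∉ σ.symm '' B := by
    rintro ⟨y, -, hy⟩
    have : σ.symm y ∈ σ.source := σ.map_target (by rw [ht]; trivial)
    rw [hs, hy] at this
    exact this rfl
  filter_upwards [h1.isClosed.isOpen_compl.mem_nhds h2] with s hsB hsa hmem
  exact hsB ⟨σ s, hmem, σ.left_inv (by rw [hs]; exact hsa)⟩

omit [MeasurableSpace E] [BorelSpace E] in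
/-- A map of a compact set missing the puncture, read in the chart, extends to the whole space. -/
theorem exists_continuous_chart_extension (hs : σ.source = {a}ᶜ) {A : Set E} (hA : IsCompact A)
    {f : A → X} (hf : Continuous f) (ha : a ∉ range f) :
    ∃ k : E → E, Continuous k ∧ ∀ p : A, k p = σ (f p) := by
  have : CompactSpace A := isCompact_iff_compactSpace.1 hA
  refine exists_continuous_factor (φ := fun p : A => (p : E)) (ψ := fun p => σ (f p))
    continuous_subtype_val ?_ (fun x y h => by rw [Subtype.ext h])
  refine σ.continuousOn.comp_continuous hf fun p => ?_
  rw [hs]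
  rintro h
  exact ha ⟨p, h⟩

omit [InnerProductSpace ℝ E] [MeasurableSpace E] [BorelSpace E] [FiniteDimensional ℝ E] in
theorem image_sphere_eq {f : sphere (0 : E) 1 → X} {k : E → E}
    (hkf : ∀ p : sphere (0 : E) 1, k p = σ (f p)) :
    k '' sphere (0 : E) 1 = σ '' range f := by
  rw [← range_comp]
  ext y
  constructor
  · rintro ⟨p, hp, rfl⟩
    exact ⟨⟨p, hp⟩, (hkf ⟨p, hp⟩).symm⟩
  · rintro ⟨p, rfl⟩
    exact ⟨p, p.2, hkf p⟩

omit [InnerProductSpace ℝ E] [MeasurableSpace E] [BorelSpace E] [FiniteDimensional ℝ E] in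
theorem apply_mem_image_sphere_iff (hs : σ.source = {a}ᶜ) {f : sphere (0 : E) 1 → X}
    (ha : a ∉ range f) {k : E → E} (hkf : ∀ p : sphere (0 : E) 1, k p = σ (f p)) {s : X}
    (hsa : s ≠ a) : σ s ∈ k '' sphere (0 : E) 1 ↔ s ∈ range f := by
  rw [image_sphere_eq hkf]
  constructor
  · rintro ⟨t, ht, hts⟩
    rwa [← σ.injOn (by rw [hs]; rintro rfl; exact ha ht) (by rw [hs]; exact hsa) hts]
  · exact fun h => mem_image_of_mem _ h

open Classical in
/-- The degree of a sphere around the point `s`, read in a chart punctured at `a`. -/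
noncomputable def chartDegree (σ : OpenPartialHomeomorph X E) (a : X) (k : E → E) (s : X) : ℝ :=
  if s = a then 0 else degree (fun x => k x - σ s) (ball 0 1)

theorem eventually_chartDegree_eq [T2Space X] (hs : σ.source = {a}ᶜ)
    (ht : σ.target = univ) {f : sphere (0 : E) 1 → X} (ha : a ∉ range f) {k : E → E}
    (hk : Continuous k) (hkf : ∀ p : sphere (0 : E) 1, k p = σ (f p)) {s : X} (hsf : s ∉ range f) :
    ∀ᶠ t in 𝓝 s, chartDegree σ a k t = chartDegree σ a k s := by
  by_cases hsa : s = a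
  · subst hsa
    filter_upwards [eventually_apply_notMem hs ht ((isCompact_closedBall (0 : E) 1).image hk)]
      with t hts
    by_cases h : t = s
    · rw [h]
    · rw [chartDegree, chartDegree, if_neg h, if_pos rfl]
      refine degree_eq_zero (by fun_prop) isOpen_ball isBounded_ball fun x hx h0 => hts h ?_
      exact ⟨x, closure_ball_subset_closedBall hx, sub_eq_zero.1 h0⟩
  · have h1 : σ s ∈ (k '' sphere (0 : E) 1)ᶜ := fun h =>
      hsf ((apply_mem_image_sphere_iff hs ha hkf hsa).1 h)
    obtain ⟨r, hr, hrk⟩ := Metric.isOpen_iff.1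
      ((isCompact_sphere (0 : E) 1).image hk).isClosed.isOpen_compl _ h1
    have h2 : ContinuousAt σ s := σ.continuousAt (by rw [hs]; exact hsa)
    filter_upwards [h2.preimage_mem_nhds (ball_mem_nhds _ hr), isOpen_ne.mem_nhds hsa]
      with t ht hta
    rw [chartDegree, chartDegree, if_neg hta, if_neg hsa]
    refine degree_congr (by fun_prop) (by fun_prop) isOpen_ball isBounded_ball
      fun x hx τ hτ h0 => ?_
    rw [frontier_ball _ one_ne_zero] at hx
    have h3 : k x = σ t + τ • (σ s - σ t) := by
      rw [← sub_eq_zero, ← h0]; module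
    refine hrk ?_ (mem_image_of_mem k hx)
    rw [h3]
    exact (convex_ball (σ s) r).add_smul_sub_mem ht (mem_ball_self hr) hτ

theorem chartDegree_eq_of_isPreconnected [T2Space X] (hs : σ.source = {a}ᶜ)
    (ht : σ.target = univ) {f : sphere (0 : E) 1 → X} (ha : a ∉ range f) {k : E → E}
    (hk : Continuous k) (hkf : ∀ p : sphere (0 : E) 1, k p = σ (f p)) {C : Set X}
    (hC : IsPreconnected C) (hCf : C ⊆ (range f)ᶜ) {s t : X} (hsC : s ∈ C) (htC : t ∈ C) :
    chartDegree σ a k t = chartDegree σ a k s := by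
  set A := {x | chartDegree σ a k x = chartDegree σ a k s} with hA
  set u := interior A
  set v := interior Aᶜ
  have key := fun x hx => eventually_chartDegree_eq hs ht ha hk hkf (s := x) (hCf hx)
  have hsu : s ∈ u := mem_interior_iff_mem_nhds.2 (key s hsC)
  have hdis : Disjoint u v := disjoint_left.2 fun x hx hx' =>
    interior_subset hx' (interior_subset hx)
  refine interior_subset (s := A) (hC.subset_left_of_subset_union (u := u) (v := v) isOpen_interior
    isOpen_interior hdis (fun x hx => ?_) ⟨s, hsC, hsu⟩ htC)
  by_cases h : chartDegree σ a k x = chartDegree σ a k s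
  · left
    refine mem_interior_iff_mem_nhds.2 ?_
    filter_upwards [key x hx] with y hy
    exact hy.trans h
  · right
    refine mem_interior_iff_mem_nhds.2 ?_
    filter_upwards [key x hx] with y hy
    exact fun hx => h (hy.symm.trans hx)

/-- In every neighbourhood of an injectivity value the degree is nonconstant. -/
theorem exists_chartDegree_ne (hs : σ.source = {a}ᶜ) (ht : σ.target = univ)
    {f : sphere (0 : E) 1 → X} (ha : a ∉ range f) {k : E → E}
    (hk : Continuous k) (hkf : ∀ p : sphere (0 : E) 1, k p = σ (f p)) {q : sphere (0 : E) 1} {r : ℝ}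
    (hr : 0 < r)
    (hinj : ∀ p p' : sphere (0 : E) 1, ‖(p : E) - q‖ < r → f p' = f p → p' = p)
    {β : Set X} (hβ : β ∈ 𝓝 (f q)) (d : ℝ) :
    ∃ s ∈ β, s ∉ range f ∧ chartDegree σ a k s ≠ d := by
  have hsrc : ∀ p, f p ∈ σ.source := fun p => by rw [hs]; exact fun h => ha ⟨p, h⟩
  have htgt : ∀ y, y ∈ σ.target := fun y => by rw [ht]; trivial
  have hinj' : ∀ p p' : E, ‖p‖ = 1 → ‖p'‖ = 1 → ‖p - q‖ < r → k p' = k p → p' = p := by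
    intro p p' hp hp' hpq h
    have e1 := hkf ⟨p, mem_sphere_zero_iff_norm.2 hp⟩
    have e2 := hkf ⟨p', mem_sphere_zero_iff_norm.2 hp'⟩
    simp only at e1 e2
    rw [e1, e2] at h
    exact congrArg Subtype.val (hinj _ _ hpq (σ.injOn (hsrc _) (hsrc _) h))
  have h1 : ∀ᶠ y in 𝓝 (k q), σ.symm y ∈ β := by
    rw [hkf]
    exact (σ.tendsto_symm (hsrc q)).eventually hβ
  obtain ⟨ε, hε, hεβ⟩ := Metric.mem_nhds_iff.1 h1
  obtain ⟨y, hy, hyK, hyd⟩ := exists_degree_ne hk (mem_sphere_zero_iff_norm.1 q.2) hr hinj' hε d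
  have hne : σ.symm y ≠ a := by
    have := σ.map_target (htgt y)
    rwa [hs] at this
  have hy' : σ (σ.symm y) = y := σ.right_inv (htgt y)
  refine ⟨σ.symm y, hεβ hy, ?_, ?_⟩
  · rwa [← apply_mem_image_sphere_iff hs ha hkf hne, hy']
  · rwa [chartDegree, if_neg hne, hy']

omit [InnerProductSpace ℝ E] [MeasurableSpace E] [BorelSpace E] [FiniteDimensional ℝ E] in
/-- The components of an open set not containing the puncture are bounded in the chart. -/
theorem isBounded_image_component [CompactSpace X] [LocallyConnectedSpace X] (hs : σ.source = {a}ᶜ)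
    {K : Set X} (hK : IsClosed K) (ha : a ∉ K) {s : X}
    (has : a ∉ connectedComponentIn Kᶜ s) :
    IsBounded (σ '' connectedComponentIn Kᶜ s) := by
  set N := connectedComponentIn Kᶜ a
  have hN : IsOpen N := hK.isOpen_compl.connectedComponentIn
  have h1 : IsCompact (σ '' Nᶜ) := hN.isClosed_compl.isCompact.image_of_continuousOn
    (σ.continuousOn.mono (by
      rw [hs]
      refine compl_subset_compl.2 (singleton_subset_iff.2 (mem_connectedComponentIn ha))))
  refine h1.isBounded.subset (image_mono fun t ht htN => has ?_)
  rw [connectedComponentIn_eq ht, ← connectedComponentIn_eq htN]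
  exact mem_connectedComponentIn ha

omit [InnerProductSpace ℝ E] [MeasurableSpace E] [BorelSpace E] [FiniteDimensional ℝ E] in
theorem frontier_image_component_subset [LocallyConnectedSpace X] [T2Space X]
    (hs : σ.source = {a}ᶜ) (ht : σ.target = univ) {K : Set X} (hK : IsClosed K) {s : X}
    (has : a ∉ connectedComponentIn Kᶜ s) :
    frontier (σ '' connectedComponentIn Kᶜ s) ⊆ σ '' K := by
  have hC : IsOpen (connectedComponentIn Kᶜ s) := hK.isOpen_compl.connectedComponentIn
  have hCs : connectedComponentIn Kᶜ s ⊆ σ.source := by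
    rw [hs]; exact fun t ht h => has (h ▸ ht)
  rw [(σ.isOpen_image_of_subset_source hC hCs).frontier_eq]
  rintro y ⟨hy, hy'⟩
  have hyt : σ (σ.symm y) = y := σ.right_inv (by rw [ht]; trivial)
  have hys : σ.symm y ∈ σ.source := σ.map_target (by rw [ht]; trivial)
  by_contra hyK
  have htK : σ.symm y ∈ Kᶜ := fun h => hyK ⟨_, h, hyt⟩
  have hO : IsOpen (σ '' (connectedComponentIn Kᶜ (σ.symm y) ∩ σ.source)) :=
    σ.isOpen_image_of_subset_source
      (hK.isOpen_compl.connectedComponentIn.inter σ.open_source) inter_subset_right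
  obtain ⟨z, ⟨t, ⟨ht1, ht2⟩, rfl⟩, ⟨t', ht', htt⟩⟩ := mem_closure_iff.1 hy _ hO
    ⟨_, ⟨mem_connectedComponentIn htK, hys⟩, hyt⟩
  rw [σ.injOn (hCs ht') ht2 htt] at ht'
  refine hy' ⟨σ.symm y, ?_, hyt⟩
  rw [connectedComponentIn_eq ht', ← connectedComponentIn_eq ht1]
  exact mem_connectedComponentIn htK

/-- Near an injectivity value, at most two components of the complement are visible. -/
theorem exists_nhds_component_eq [CompactSpace X] [LocallyConnectedSpace X] [T2Space X]
    (hs : σ.source = {a}ᶜ) (ht : σ.target = univ)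
    {f : sphere (0 : E) 1 → X} (hf : Continuous f) (ha : a ∉ range f) {q : sphere (0 : E) 1} {r : ℝ}
    (hr : 0 < r)
    (hinj : ∀ p p' : sphere (0 : E) 1, ‖(p : E) - q‖ < r → f p' = f p → p' = p) :
    ∃ β ∈ 𝓝 (f q), ∀ x ∈ β, ∀ y ∈ β, ∀ z ∈ β, x ∉ range f → y ∉ range f → z ∉ range f →
      connectedComponentIn (range f)ᶜ x ≠ connectedComponentIn (range f)ᶜ y →
      connectedComponentIn (range f)ᶜ z = connectedComponentIn (range f)ᶜ x ∨
      connectedComponentIn (range f)ᶜ z = connectedComponentIn (range f)ᶜ y := by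
  obtain ⟨k, hk, hkf⟩ := exists_continuous_chart_extension hs (isCompact_sphere (0 : E) 1) hf ha
  have hsrc : ∀ p, f p ∈ σ.source := fun p => by rw [hs]; exact fun h => ha ⟨p, h⟩
  have hinj' : ∀ p p' : E, ‖p‖ = 1 → ‖p'‖ = 1 → ‖p - q‖ < r → k p' = k p → p' = p := by
    intro p p' hp hp' hpq h
    have e1 := hkf ⟨p, mem_sphere_zero_iff_norm.2 hp⟩
    have e2 := hkf ⟨p', mem_sphere_zero_iff_norm.2 hp'⟩
    simp only at e1 e2
    rw [e1, e2] at h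
    exact congrArg Subtype.val (hinj _ _ hpq (σ.injOn (hsrc _) (hsrc _) h))
  obtain ⟨ε, hε, hε3⟩ := exists_ball_no_three hk (mem_sphere_zero_iff_norm.1 q.2) hr hinj'
  have hK : IsClosed (range f) := (isCompact_range hf).isClosed
  set cc := connectedComponentIn (range f)ᶜ with hcc
  have hmem : ∀ {x}, x ∉ range f → x ∈ cc x := fun h => mem_connectedComponentIn h
  have hccs : ∀ {x}, a ∉ cc x → cc x ⊆ σ.source := fun h => by
    rw [hs]; exact fun t ht h' => h (h' ▸ ht)
  have hdis : ∀ {x y}, cc x ≠ cc y → Disjoint (cc x) (cc y) := fun h =>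
    disjoint_left.2 fun t h1 h2 => h ((connectedComponentIn_eq h1).trans
      (connectedComponentIn_eq h2).symm)
  have core : ∀ x y z, (x ∈ σ.source ∧ σ x ∈ ball (k q) ε) → (y ∈ σ.source ∧ σ y ∈ ball (k q) ε) →
      (z ∈ σ.source ∧ σ z ∈ ball (k q) ε) → x ∉ range f → y ∉ range f → z ∉ range f →
      cc x ≠ cc y → cc x ≠ cc z → cc y ≠ cc z → a ∉ cc x → a ∉ cc y → False := by
    intro x y z ⟨hx, hxε⟩ ⟨hy, hyε⟩ ⟨hz, hzε⟩ hxK hyK hzK hxy hxz hyz hax hay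
    have hne : ∀ {t}, t ∈ σ.source → t ∉ range f → σ t ∉ k '' sphere 0 1 := fun h h' h'' => by
      rw [hs] at h
      exact h' ((apply_mem_image_sphere_iff hs ha hkf h).1 h'')
    have hzn : ∀ {x}, a ∉ cc x → cc x ≠ cc z → σ z ∉ σ '' cc x := by
      rintro x h1 h2 ⟨t, ht, htz⟩
      rw [σ.injOn (hccs h1 ht) hz htz] at ht
      exact h2 (connectedComponentIn_eq ht)
    refine hε3 (σ '' cc x) (σ '' cc y)
      (σ.isOpen_image_of_subset_source hK.isOpen_compl.connectedComponentIn (hccs hax))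
      (σ.isOpen_image_of_subset_source hK.isOpen_compl.connectedComponentIn (hccs hay))
      (isBounded_image_component hs hK ha hax) (isBounded_image_component hs hK ha hay)
      ?_ ?_ ?_ _ (mem_image_of_mem σ (hmem hxK)) _ (mem_image_of_mem σ (hmem hyK)) (σ z)
      (hzn hax hxz) (hzn hay hyz) (hne hx hxK) (hne hy hyK) (hne hz hzK) hxε hyε hzε
    · refine disjoint_left.2 ?_
      rintro _ ⟨t, ht, rfl⟩ ⟨t', ht', h⟩
      rw [σ.injOn (hccs hay ht') (hccs hax ht) h] at ht'
      exact (hdis hxy).le_bot ⟨ht, ht'⟩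
    · rw [image_sphere_eq hkf]
      exact frontier_image_component_subset hs ht hK hax
    · rw [image_sphere_eq hkf]
      exact frontier_image_component_subset hs ht hK hay
  refine ⟨{x | x ∈ σ.source ∧ σ x ∈ ball (k q) ε}, ?_, ?_⟩
  · have h1 : σ ⁻¹' ball (k q) ε ∈ 𝓝 (f q) := (σ.continuousAt (hsrc q)).preimage_mem_nhds (by
      rw [hkf]; exact ball_mem_nhds _ hε)
    exact inter_mem (σ.open_source.mem_nhds (hsrc q)) h1
  · intro x hx y hy z hz hxK hyK hzK hxy
    by_contra! hcon
    obtain ⟨hzx, hzy⟩ := hcon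
    by_cases hax : a ∈ cc x
    · have hay : a ∉ cc y := fun h => (hdis hxy).le_bot ⟨hax, h⟩
      have haz : a ∉ cc z := fun h => (hdis hzx).le_bot ⟨h, hax⟩
      exact core y z x hy hz hx hyK hzK hxK hzy.symm hxy.symm hzx hay haz
    · by_cases hay : a ∈ cc y
      · have haz : a ∉ cc z := fun h => (hdis hzy).le_bot ⟨h, hay⟩
        exact core x z y hx hz hy hxK hzK hyK hzx.symm hxy hzy hax haz
      · exact core x y z hx hy hz hxK hyK hzK hxy hzx.symm hzy.symm hax hay

end PuncturedCharts

section Separation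

variable {E : Type*} [NormedAddCommGroup E] [InnerProductSpace ℝ E] [FiniteDimensional ℝ E]
  [MeasurableSpace E] [BorelSpace E]
variable {X : Type*} [TopologicalSpace X]

/-- A map of the sphere that is injective near `q` is not onto. -/
theorem exists_notMem_range_of_injective_near [T2Space X] {σ : X → OpenPartialHomeomorph X E}
    (hs : ∀ a, (σ a).source = {a}ᶜ) (ht : ∀ a, (σ a).target = univ)
    {f : sphere (0 : E) 1 → X} (hf : Continuous f) {q : sphere (0 : E) 1} {r : ℝ} (hr : 0 < r)
    (hinj : ∀ p p' : sphere (0 : E) 1, ‖(p : E) - q‖ < r → f p' = f p → p' = p) :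
    ∃ a, a ∉ range f := by
  by_contra! hsurj
  have hq1 : ‖(q : E)‖ = 1 := mem_sphere_zero_iff_norm.1 q.2
  obtain ⟨a, haq⟩ : ∃ a, f q ≠ a := ⟨(σ (f q)).symm 0, fun h => by
    have := (σ (f q)).map_target (x := 0) (by rw [ht]; trivial)
    rw [hs, ← h] at this
    exact this rfl⟩
  obtain ⟨ρ, hρ, hρa⟩ := Metric.nhds_basis_closedBall.mem_iff.1
    (hf.continuousAt.preimage_mem_nhds (isOpen_ne.mem_nhds haq))
  set δ := min (r / 2) (min 1 ρ) with hδ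
  have hδ0 : 0 < δ := by positivity
  have hδr : δ < r := (min_le_left _ _).trans_lt (by linarith)
  have hδ1 : δ ≤ 1 := (min_le_right _ _).trans (min_le_left _ _)
  have hδρ : δ ≤ ρ := (min_le_right _ _).trans (min_le_right _ _)
  have hsrc : ∀ p ∈ closedBall q δ, f p ∈ (σ a).source := fun p hp => by
    rw [hs]
    exact hρa (closedBall_subset_closedBall hδρ hp)
  have hpr : ∀ p ∈ closedBall q δ, ‖(p : E) - q‖ ≤ δ := fun p hp => by
    rwa [mem_closedBall, Subtype.dist_eq, dist_eq_norm] at hp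
  -- values near `f q` are attained on the cap
  have hT : IsCompact (f '' (ball q δ)ᶜ) := isOpen_ball.isClosed_compl.isCompact.image hf
  have hqT : f q ∉ f '' (ball q δ)ᶜ := by
    rintro ⟨p, hp, hpq⟩
    have := hinj q p (by simpa using hr) hpq
    exact hp (by rw [this]; exact mem_ball_self hδ0)
  have hqs : f q ∈ (σ a).source := hsrc q (mem_closedBall_self hδ0.le)
  have h1 : ∀ᶠ y in 𝓝 (σ a (f q)), (σ a).symm y ∈ (f '' (ball q δ)ᶜ)ᶜ :=
    ((σ a).tendsto_symm hqs).eventually (hT.isClosed.isOpen_compl.mem_nhds hqT)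
  obtain ⟨η, hη, hη'⟩ := Metric.nhds_basis_closedBall.mem_iff.1 h1
  have : CompactSpace (closedBall q δ) := isCompact_iff_compactSpace.1 isClosed_closedBall.isCompact
  set L : E →L[ℝ] E := ContinuousLinearMap.id ℝ E - (innerSL ℝ (q : E)).smulRight (q : E) with hL
  have hLa : ∀ y, L y = y - inner ℝ (q : E) y • (q : E) := fun y => by simp [hL]
  have hqq : inner ℝ (q : E) (q : E) = 1 := by rw [real_inner_self_eq_norm_sq, hq1]; norm_num
  refine not_closedBall_subset_range (X := closedBall q δ) (φ := fun p => σ a (f p))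
    (ψ := fun p => L p) ?_ (by fun_prop) ?_ ?_ L ?_ (fun p => ?_) (σ a (f q)) hη ?_
  · exact (σ a).continuousOn.comp_continuous (by fun_prop) fun p => hsrc p p.2
  · intro p p' h
    have h2 := (σ a).injOn (hsrc p p.2) (hsrc p' p'.2) h
    exact Subtype.ext (hinj p' p ((hpr _ p'.2).trans_lt hδr) h2)
  · intro p p' h
    have hn : ∀ p : sphere (0 : E) 1, inner ℝ (L p) (L p) = 1 - inner ℝ (q : E) (p : E) ^ 2 := by
      intro p
      have hp1 : inner ℝ (p : E) (p : E) = 1 := by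
        rw [real_inner_self_eq_norm_sq, mem_sphere_zero_iff_norm.1 p.2]; norm_num
      rw [hLa, inner_sub_left, inner_sub_right, inner_sub_right, real_inner_smul_left,
        real_inner_smul_left, real_inner_smul_right, real_inner_smul_right, hqq, hp1,
        real_inner_comm (q : E) (p : E)]
      ring
    have hpos : ∀ p ∈ closedBall q δ, 0 < inner ℝ (q : E) (p : E) := fun p hp => by
      have h3 := norm_sub_sq_of_unit (mem_sphere_zero_iff_norm.1 p.2) hq1
      have h4 := (hpr p hp).trans hδ1
      rw [real_inner_comm] at h3
      nlinarith [norm_nonneg ((p : E) - q)]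
    have h5 := hn p
    have h6 := hn p'
    simp only at h
    rw [h, h6] at h5
    have h7 : inner ℝ (q : E) (p : E) = inner ℝ (q : E) (p' : E) := by
      nlinarith [hpos p p.2, hpos p' p'.2]
    rw [hLa, hLa, h7] at h
    exact Subtype.ext (Subtype.ext (sub_left_injective h))
  · refine LinearMap.det_eq_zero_iff_ker_ne_bot.2 fun h => ?_
    have h2 : (q : E) ∈ LinearMap.ker (L : E →ₗ[ℝ] E) := by
      rw [LinearMap.mem_ker]
      change L q = 0
      rw [hLa, hqq, one_smul, sub_self]
    rw [h, Submodule.mem_bot] at h2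
    rw [h2, norm_zero] at hq1
    exact zero_ne_one hq1
  · simp only [hLa, inner_sub_right, real_inner_smul_right, hqq]
    simp
  · intro y hy
    obtain ⟨p, hp⟩ := hsurj ((σ a).symm y)
    have h2 : p ∈ ball q δ := by
      by_contra h
      exact hη' hy ⟨p, h, hp⟩
    refine ⟨⟨p, ball_subset_closedBall h2⟩, ?_⟩
    simp only [hp]
    exact (σ a).right_inv (by rw [ht]; trivial)

/-- A map of the ball missing `a` and `b` forces the degrees of its boundary around these points to
agree. -/
theorem chartDegree_eq_zero_of_extension {a : X} {σ : OpenPartialHomeomorph X E}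
    (hs : σ.source = {a}ᶜ) {F : closedBall (0 : E) 1 → X}
    (hF : Continuous F) {f : sphere (0 : E) 1 → X}
    (hFf : ∀ x : sphere (0 : E) 1, F ⟨x.1, sphere_subset_closedBall x.2⟩ = f x)
    (haF : a ∉ range F) {k : E → E} (hk : Continuous k)
    (hkf : ∀ p : sphere (0 : E) 1, k p = σ (f p)) {b : X} (hbF : b ∉ range F) :
    chartDegree σ a k b = 0 := by
  by_cases hba : b = a
  · rw [chartDegree, if_pos hba]
  obtain ⟨k', hk', hkF⟩ := exists_continuous_chart_extension hs (isCompact_closedBall (0 : E) 1)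
    hF haF
  have h0 : ∀ x ∈ closedBall (0 : E) 1, k' x - σ b ≠ 0 := fun x hx h => by
    have h1 := hkF ⟨x, hx⟩
    simp only at h1
    rw [h1] at h
    refine hbF ⟨⟨x, hx⟩, σ.injOn ?_ ?_ (sub_eq_zero.1 h)⟩
    · rw [hs]; exact fun h => haF ⟨_, h⟩
    · rw [hs]; exact hba
  have heq : ∀ x ∈ sphere (0 : E) 1, k x = k' x := fun x hx => by
    have h1 := hkF ⟨x, sphere_subset_closedBall hx⟩
    have h2 := hkf ⟨x, hx⟩
    simp only at h1 h2
    rw [h1, h2, ← hFf]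
  rw [chartDegree, if_neg hba]
  have hfr : frontier (ball (0 : E) 1) = sphere 0 1 := frontier_ball _ one_ne_zero
  rw [degree_congr_of_eqOn (f := fun x => k x - σ b) (g := fun x => k' x - σ b) (by fun_prop)
    (by fun_prop) isOpen_ball isBounded_ball]
  · exact degree_eq_zero (by fun_prop) isOpen_ball isBounded_ball fun x hx =>
      h0 x (closure_ball_subset_closedBall hx)
  · intro x hx
    rw [hfr] at hx
    rw [heq x hx]
    exact h0 x (sphere_subset_closedBall hx)
  · intro x hx
    rw [hfr] at hx
    simp only [heq x hx]

/-- The separation theorem in a space all of whose punctures are Euclidean. -/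
theorem exists_two_components [CompactSpace X] [LocallyConnectedSpace X] [T2Space X]
    {σ : X → OpenPartialHomeomorph X E}
    (hs : ∀ a, (σ a).source = {a}ᶜ) (ht : ∀ a, (σ a).target = univ)
    {f : sphere (0 : E) 1 → X} (hf : Continuous f) {q : sphere (0 : E) 1} {r : ℝ} (hr : 0 < r)
    (hinj : ∀ p p' : sphere (0 : E) 1, ‖(p : E) - q‖ < r → f p' = f p → p' = p) :
    ∃ s ∉ range f, ∃ t ∉ range f,
      connectedComponentIn (range f)ᶜ s ≠ connectedComponentIn (range f)ᶜ t ∧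
      f q ∈ closure (connectedComponentIn (range f)ᶜ s) ∧
      f q ∈ closure (connectedComponentIn (range f)ᶜ t) ∧
      (∀ u ∉ range f, f q ∈ closure (connectedComponentIn (range f)ᶜ u) →
        connectedComponentIn (range f)ᶜ u = connectedComponentIn (range f)ᶜ s ∨
        connectedComponentIn (range f)ᶜ u = connectedComponentIn (range f)ᶜ t) ∧
      ∀ F : closedBall (0 : E) 1 → X, Continuous F →
        (∀ x : sphere (0 : E) 1, F ⟨x.1, sphere_subset_closedBall x.2⟩ = f x) →
        connectedComponentIn (range f)ᶜ s ⊆ range F ∨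
        connectedComponentIn (range f)ᶜ t ⊆ range F := by
  obtain ⟨a, ha⟩ := exists_notMem_range_of_injective_near hs ht hf hr hinj
  set cc := connectedComponentIn (range f)ᶜ with hcc
  have hmem : ∀ {x}, x ∉ range f → x ∈ cc x := fun h => mem_connectedComponentIn h
  have hsub : ∀ x, cc x ⊆ (range f)ᶜ := fun x => connectedComponentIn_subset _ _
  have heq : ∀ {x y}, y ∈ cc x → cc x = cc y := fun h => connectedComponentIn_eq h
  obtain ⟨β, hβ, hβ3⟩ := exists_nhds_component_eq (hs a) (ht a) hf ha hr hinj
  -- arbitrarily close to `f q` there are points in distinct components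
  have hpair : ∀ N ∈ 𝓝 (f q), ∃ s ∈ N, ∃ t ∈ N, s ∉ range f ∧ t ∉ range f ∧ cc s ≠ cc t := by
    intro N hN
    obtain ⟨k, hk, hkf⟩ :=
      exists_continuous_chart_extension (hs a) (isCompact_sphere (0 : E) 1) hf ha
    obtain ⟨s, hsN, hsf, -⟩ := exists_chartDegree_ne (hs a) (ht a) ha hk hkf hr hinj hN 0
    obtain ⟨t, htN, htf, htd⟩ := exists_chartDegree_ne (hs a) (ht a) ha hk hkf hr hinj hN
      (chartDegree (σ a) a k s)
    refine ⟨s, hsN, t, htN, hsf, htf, fun h => htd ?_⟩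
    exact chartDegree_eq_of_isPreconnected (hs a) (ht a) ha hk hkf
      isPreconnected_connectedComponentIn (hsub s) (hmem hsf)
      (show t ∈ cc s from h ▸ hmem htf)
  obtain ⟨s, hsβ, t, htβ, hsf, htf, hst⟩ := hpair β hβ
  have hβ2 : ∀ u ∈ β, u ∉ range f → cc u = cc s ∨ cc u = cc t := fun u hu huf =>
    hβ3 s hsβ t htβ u hu hsf htf huf hst
  have hclos : f q ∈ closure (cc s) ∧ f q ∈ closure (cc t) := by
    constructor <;> refine mem_closure_iff_nhds.2 fun N hN => ?_ <;>
    obtain ⟨u, ⟨huN, huβ⟩, v, ⟨hvN, hvβ⟩, huf, hvf, huv⟩ := hpair _ (inter_mem hN hβ) <;>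
    rcases hβ2 u huβ huf with h1 | h1 <;> rcases hβ2 v hvβ hvf with h2 | h2
    all_goals first
      | exact absurd (h1.trans h2.symm) huv
      | exact ⟨u, huN, h1 ▸ hmem huf⟩
      | exact ⟨v, hvN, h2 ▸ hmem hvf⟩
  refine ⟨s, hsf, t, htf, hst, hclos.1, hclos.2, fun u huf hu => ?_, fun F hF hFf => ?_⟩
  · obtain ⟨v, hvβ, hvu⟩ := mem_closure_iff_nhds.1 hu β hβ
    rw [heq hvu]
    exact hβ2 v hvβ (hsub u hvu)
  · by_contra! hcon
    obtain ⟨h1, h2⟩ := hcon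
    obtain ⟨b, hbs, hbF⟩ := not_subset.1 h1
    obtain ⟨c, hct, hcF⟩ := not_subset.1 h2
    have hb := hsub s hbs
    obtain ⟨k, hk, hkf⟩ :=
      exists_continuous_chart_extension (hs b) (isCompact_sphere (0 : E) 1) hf hb
    obtain ⟨u, huβ, huf, hud⟩ := exists_chartDegree_ne (hs b) (ht b) hb hk hkf hr hinj hβ 0
    have hz : ∀ x ∉ range F, cc u = cc x → x ∉ range f → False := fun x hxF hux hxf => hud <| by
      rw [← chartDegree_eq_zero_of_extension (hs b) hF hFf hbF hk hkf hxF]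
      exact chartDegree_eq_of_isPreconnected (hs b) (ht b) hb hk hkf
        isPreconnected_connectedComponentIn (hsub x) (hmem hxf)
        (show u ∈ cc x from hux ▸ hmem huf)
    rcases hβ2 u huβ huf with h | h
    · exact hz b hbF (h.trans (heq hbs)) hb
    · exact hz c hcF (h.trans (heq hct)) (hsub t hct)

end Separation

end AnalyticDegree

/-- **Strong Jordan separation.** Let `n ≥ 2` and let `f : Sⁿ → Sⁿ⁺¹` be a
continuous map whose set of injectivity contains a nonempty open set `U`, and let `q ∈ U`.
Then: (1) `f(Sⁿ)` separates `Sⁿ⁺¹`; (2) there are precisely two connected components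
`U₁, U₂` of `Sⁿ⁺¹ \ f(Sⁿ)` containing `f(q)` in their closure; (3) any continuous
extension `F : Dⁿ⁺¹ → Sⁿ⁺¹` of `f` to the closed unit ball surjects onto `U₁` or `U₂`. -/
theorem strong_jordan_separation
    (n : ℕ) (hn : 2 ≤ n)
    (f : (Metric.sphere (0 : EuclideanSpace ℝ (Fin (n + 1))) 1) →
         (Metric.sphere (0 : EuclideanSpace ℝ (Fin (n + 2))) 1))
    (hf : Continuous f)
    (U : Set (Metric.sphere (0 : EuclideanSpace ℝ (Fin (n + 1))) 1))
    (hUopen : IsOpen U) (hUne : U.Nonempty)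
    (hUinj : ∀ p ∈ U, ∀ q, f q = f p → q = p)
    (q : Metric.sphere (0 : EuclideanSpace ℝ (Fin (n + 1))) 1) (hq : q ∈ U) :
    ((Set.range f)ᶜ.Nonempty ∧ ¬ IsPreconnected (Set.range f)ᶜ) ∧
    ∃ U₁ U₂ : Set (Metric.sphere (0 : EuclideanSpace ℝ (Fin (n + 2))) 1),
      U₁ ≠ U₂ ∧
      IsConnCompIn (Set.range f)ᶜ U₁ ∧ IsConnCompIn (Set.range f)ᶜ U₂ ∧
      f q ∈ closure U₁ ∧ f q ∈ closure U₂ ∧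
      (∀ C, IsConnCompIn (Set.range f)ᶜ C → f q ∈ closure C → C = U₁ ∨ C = U₂) ∧
      ∀ F : (Metric.closedBall (0 : EuclideanSpace ℝ (Fin (n + 1))) 1) →
            (Metric.sphere (0 : EuclideanSpace ℝ (Fin (n + 2))) 1),
        Continuous F →
        (∀ x : (Metric.sphere (0 : EuclideanSpace ℝ (Fin (n + 1))) 1),
          F ⟨x.1, Metric.sphere_subset_closedBall x.2⟩ = f x) →
        U₁ ⊆ Set.range F ∨ U₂ ⊆ Set.range F := by
  have : Fact (Module.finrank ℝ (EuclideanSpace ℝ (Fin (n + 2))) = (n + 1) + 1) := ⟨by simp⟩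
  have : LocallyConnectedSpace (Metric.sphere (0 : EuclideanSpace ℝ (Fin (n + 2))) 1) :=
    ChartedSpace.locallyConnectedSpace (EuclideanSpace ℝ (Fin (n + 1))) _
  obtain ⟨r, hr, hrU⟩ := Metric.isOpen_iff.1 hUopen q hq
  obtain ⟨s, hs, t, ht, hst, hqs, hqt, huniq, hF⟩ := AnalyticDegree.exists_two_components
    (σ := fun a => stereographic' (n + 1) a) (fun a => stereographic'_source a)
    (fun a => stereographic'_target a) hf (q := q) hr (fun p p' hp h =>
      hUinj p (hrU (by rwa [Metric.mem_ball, Subtype.dist_eq, dist_eq_norm])) p' h)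
  refine ⟨⟨⟨s, hs⟩, fun hpre => hst ?_⟩, _, _, hst, ⟨s, hs, rfl⟩, ⟨t, ht, rfl⟩, hqs, hqt, ?_, hF⟩
  · rw [hpre.connectedComponentIn hs, hpre.connectedComponentIn ht]
  · rintro _ ⟨u, hu, rfl⟩ hqu
    exact huniq u hu hqu
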